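/- arXiv:1609.06064 — 2 statements merged into one kernel-verified Lean document; each statement's English description precedes it below -/
import Mathlib

section
/- Let φ be a Sturmian coloring of a d-regular tree and suppose that G_n has a cycle. Then: (1) the special ball S_n lies on the cycle; (2) apart from S_n itself, S_n is adjacent in G_n only to A_n, B_n, and C_n. -/
open scoped Classical

noncomputable section

namespace Sturm

variable {V α : Type}

/-- `G` is a `d`-regular tree. -/
structure IsRegularTree (G : SimpleGraph V) (d : ℕ) : Prop where
  isTree : G.IsTree
  regular : ∀ v : V, (G.neighborSet v).ncard = d

/-- Color-preserving isomorphism of the `n`-balls centered at `x` and `y`,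
sending center to center. -/
def BallEquiv (G : SimpleGraph V) (φ : V → α) (n : ℕ) (x y : V) : Prop :=
  ∃ f : {z : V // G.dist x z ≤ n} ≃ {z : V // G.dist y z ≤ n},
    (∀ u v : {z : V // G.dist x z ≤ n}, G.Adj u.1 v.1 ↔ G.Adj (f u).1 (f v).1) ∧
    (∀ u : {z : V // G.dist x z ≤ n}, φ (f u).1 = φ u.1) ∧
    ((f ⟨x, by rw [SimpleGraph.dist_self]; exact Nat.zero_le n⟩).1 = y)

/-- The class of the `n`-ball at `x`, viewed as the set of all centers of equivalent balls. -/
def ballClass (G : SimpleGraph V) (φ : V → α) (n : ℕ) (x : V) : Set V :=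
  {y | BallEquiv G φ n x y}

/-- The set `B_n(φ)` of classes of `n`-balls occurring in `(T, φ)`. -/
def ballClasses (G : SimpleGraph V) (φ : V → α) (n : ℕ) : Set (Set V) :=
  {C | ∃ x, C = ballClass G φ n x}

/-- A coloring is Sturmian if its factor complexity is `n + 2`. -/
def IsSturmian (G : SimpleGraph V) (φ : V → α) : Prop :=
  ∀ n, (ballClasses G φ n).ncard = n + 2

/-- `x` is the center of a special `n`-ball. -/
def IsSpecialVert (G : SimpleGraph V) (φ : V → α) (n : ℕ) (x : V) : Prop :=
  ∃ y, BallEquiv G φ n x y ∧ ¬ BallEquiv G φ (n + 1) x y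

/-- `S` is a special class of `n`-balls: the restriction of two distinct classes of
`(n+1)`-balls. -/
def IsSpecialClass (G : SimpleGraph V) (φ : V → α) (n : ℕ) (S : Set V) : Prop :=
  ∃ x, S = ballClass G φ n x ∧ IsSpecialVert G φ n x

/-- The class `D` is always adjacent to the class `E`. -/
def AlwaysAdjTo (G : SimpleGraph V) (D E : Set V) : Prop :=
  ∀ x ∈ D, ∃ y, G.Adj x y ∧ y ∈ E

/-- The classes `D` and `E` are (always) adjacent. -/
def AlwaysAdj (G : SimpleGraph V) (D E : Set V) : Prop :=
  AlwaysAdjTo G D E ∧ AlwaysAdjTo G E D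

/-- The classes `D` and `E` can be adjacent. -/
def CanAdj (G : SimpleGraph V) (D E : Set V) : Prop :=
  ∃ x ∈ D, ∃ y ∈ E, G.Adj x y

/-- The number of neighbors of `x` lying in (i.e. being centers of balls of class) `E`. -/
def nbrCount (G : SimpleGraph V) (x : V) (E : Set V) : ℕ :=
  (G.neighborSet x ∩ E).ncard

/-- The data of the labels `S_n, C_n, A_n, B_n` for a Sturmian coloring, normalized as in
the paper: `S_0 = A_0 = [a]`, `B_0 = [b]`, `A_{n+1}` (resp. `B_{n+1}`) is always adjacent
to `A_n` (resp. `B_n`), and `A_{n+1}, B_{n+1}` are the two distinct extensions of `S_n`. -/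
structure Labeling (G : SimpleGraph V) (φ : V → α) (a b : α) where
  S : ℕ → Set V
  C : ℕ → Set V
  A : ℕ → Set V
  B : ℕ → Set V
  S_special : ∀ n, IsSpecialClass G φ n (S n)
  C_central : ∀ n, ∃ x, IsSpecialVert G φ (n + 1) x ∧ S (n + 1) = ballClass G φ (n + 1) x ∧
      C n = ballClass G φ n x
  A0_eq_S0 : A 0 = S 0
  A0_col : ∃ x, φ x = a ∧ A 0 = ballClass G φ 0 x
  B0_col : ∃ x, φ x = b ∧ B 0 = ballClass G φ 0 x
  A_ext : ∀ n, ∃ x, IsSpecialVert G φ n x ∧ S n = ballClass G φ n x ∧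
      A (n + 1) = ballClass G φ (n + 1) x
  B_ext : ∀ n, ∃ x, IsSpecialVert G φ n x ∧ S n = ballClass G φ n x ∧
      B (n + 1) = ballClass G φ (n + 1) x
  AB_ne : ∀ n, A (n + 1) ≠ B (n + 1)
  A_adj : ∀ n, AlwaysAdjTo G (A (n + 1)) (A n)
  B_adj : ∀ n, AlwaysAdjTo G (B (n + 1)) (B n)

/-- A cycle (of length `≥ 3`, with pairwise distinct vertices) in the graph `G_n` of
classes of `n`-balls, where classes are joined when they can be adjacent. -/
def IsCycleIn (G : SimpleGraph V) (φ : V → α) (n k : ℕ) (c : ℕ → Set V) : Prop :=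
  3 ≤ k ∧ (∀ i < k, c i ∈ ballClasses G φ n) ∧
    (∀ i < k, CanAdj G (c i) (c ((i + 1) % k))) ∧
    (∀ i < k, ∀ j < k, c i = c j → i = j)

/-- The graph `G_n` contains a cycle. -/
def HasCycle (G : SimpleGraph V) (φ : V → α) (n : ℕ) : Prop :=
  ∃ k c, IsCycleIn G φ n k c

/-! ## Edge-indexed colored graphs -/

/-- An edge-indexed graph, with vertices colored by `α` and labeled by classes
(sets of vertices of the underlying tree `V`). Index `0` means "no edge". -/
structure EIG (V α : Type) where
  Vert : Type
  idx : Vert → Vert → ℕ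
  col : Vert → α
  lab : Vert → Set V

/-- Isomorphism of colored edge-indexed graphs. -/
structure EIGIso (X Y : EIG V α) where
  e : X.Vert ≃ Y.Vert
  idx_eq : ∀ u v, Y.idx (e u) (e v) = X.idx u v
  col_eq : ∀ u, Y.col (e u) = X.col u

/-- The index `i_A(D, E)` (resp. `i_B`, `i`) at the level of classes: the number of
neighbors, in class `E`, of a representative center of `D`; when `D` is the special
class `Sp`, the representative is taken with extension of class `Ext`. -/
def classIdx (G : SimpleGraph V) (Sp Ext : Set V) (D E : Set V) : ℕ :=
  if D = Sp then (if h : Ext.Nonempty then nbrCount G h.some E else 0)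
  else (if h : D.Nonempty then nbrCount G h.some E else 0)

/-- The classes of `n`-balls joined to `Sp` by a path of edges of positive `J`-index. -/
def reachSet (G : SimpleGraph V) (φ : V → α) (n : ℕ) (Sp : Set V)
    (J : Set V → Set V → ℕ) : Set (Set V) :=
  {D | ∃ k, ∃ c : ℕ → Set V, c 0 = Sp ∧ c k = D ∧ (∀ i ≤ k, c i ∈ ballClasses G φ n) ∧
    ∀ i < k, 0 < J (c i) (c (i + 1)) ∨ 0 < J (c (i + 1)) (c i)}

/-- Color of a class: the color of (the center of) any of its representatives. -/
def colOf [Nonempty V] (φ : V → α) (D : Set V) : α :=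
  if h : D.Nonempty then φ h.some else φ (Classical.arbitrary V)

/-- The edge-indexed graph `G^A_n` (when `Ext = A_{n+1}`) resp. `G^B_n`. -/
def sideEIG [Nonempty V] (G : SimpleGraph V) (φ : V → α) (n : ℕ) (Sp Ext : Set V) :
    EIG V α where
  Vert := {D : Set V // D ∈ reachSet G φ n Sp (classIdx G Sp Ext)}
  idx := fun D E => classIdx G Sp Ext D.1 E.1
  col := fun D => colOf φ D.1
  lab := fun D => D.1

variable {G : SimpleGraph V} {φ : V → α} {a b : α}

/-- The edge-indexed graph `G^A_n`. -/
def GAeig [Nonempty V] (L : Labeling G φ a b) (n : ℕ) : EIG V α :=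
  sideEIG G φ n (L.S n) (L.A (n + 1))

/-- The edge-indexed graph `G^B_n`. -/
def GBeig [Nonempty V] (L : Labeling G φ a b) (n : ℕ) : EIG V α :=
  sideEIG G φ n (L.S n) (L.B (n + 1))

/-- Vertex set of `G^A_n`. -/
def VGAset (L : Labeling G φ a b) (n : ℕ) : Set (Set V) :=
  reachSet G φ n (L.S n) (classIdx G (L.S n) (L.A (n + 1)))

/-- Vertex set of `G^B_n`. -/
def VGBset (L : Labeling G φ a b) (n : ℕ) : Set (Set V) :=
  reachSet G φ n (L.S n) (classIdx G (L.S n) (L.B (n + 1)))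

/-- `G^A_n` or `G^B_n`, selected by a letter (`true = A`, `false = B`). -/
def GsideEIG [Nonempty V] (L : Labeling G φ a b) (n : ℕ) : Bool → EIG V α
  | true => GAeig L n
  | false => GBeig L n

/-- Vertex set of `G^A_n` or `G^B_n`, selected by a letter. -/
def VGside (L : Labeling G φ a b) (n : ℕ) : Bool → Set (Set V)
  | true => VGAset L n
  | false => VGBset L n

/-- A single vertex with a loop of index `d` (the graph `G^A_{-1} = G^B_{-1} = F^._{-1}`). -/
def baseEIG (V : Type) (x : α) (d : ℕ) : EIG V α where
  Vert := PUnit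
  idx := fun _ _ => d
  col := fun _ => x
  lab := fun _ => Set.univ

/-- `GAx L d (n+1) = G^A_n`, and `GAx L d 0 = G^A_{-1}`. -/
def GAx [Nonempty V] (L : Labeling G φ a b) (d : ℕ) : ℕ → EIG V α
  | 0 => baseEIG V a d
  | n + 1 => GAeig L n

/-- `GBx L d (n+1) = G^B_n`, and `GBx L d 0 = G^B_{-1}`. -/
def GBx [Nonempty V] (L : Labeling G φ a b) (d : ℕ) : ℕ → EIG V α
  | 0 => baseEIG V b d
  | n + 1 => GBeig L n

/-- `Cx L (n+1) = C_n`, and `Cx L 0 = C_{-1}` (the class of the empty ball). -/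
def Cx (L : Labeling G φ a b) : ℕ → Set V
  | 0 => Set.univ
  | n + 1 => L.C n

/-! ## Concatenations -/

/-- The `(i)`-concatenation of two edge-indexed graphs at the end vertices `v, v'`
(which are identified). -/
def concatI (X Y : EIG V α) (v : X.Vert) (v' : Y.Vert) (i : ℕ) : EIG V α where
  Vert := X.Vert ⊕ {w : Y.Vert // w ≠ v'}
  idx := fun p q =>
    match p, q with
    | Sum.inl u, Sum.inl w =>
        if u = v ∧ w ≠ v then (if X.idx u w = 0 then 0 else i) else X.idx u w
    | Sum.inl u, Sum.inr w => if u = v then Y.idx v' w.1 - i else 0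
    | Sum.inr w, Sum.inl u => if u = v then Y.idx w.1 v' else 0
    | Sum.inr w, Sum.inr w2 => Y.idx w.1 w2.1
  col := Sum.elim X.col (fun w => Y.col w.1)
  lab := Sum.elim X.lab (fun w => Y.lab w.1)

/-- The `(i,j)`-concatenation of two edge-indexed graphs at the end vertices `v, v'`
(which stay distinct, joined by a new edge of indices `i`, `j`). -/
def concatIJ (X Y : EIG V α) (v : X.Vert) (v' : Y.Vert) (i j : ℕ) : EIG V α where
  Vert := X.Vert ⊕ Y.Vert
  idx := fun p q =>
    match p, q with
    | Sum.inl u, Sum.inl w => if u = v ∧ w = v then X.idx v v - i else X.idx u w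
    | Sum.inl u, Sum.inr w => if u = v ∧ w = v' then i else 0
    | Sum.inr w, Sum.inl u => if w = v' ∧ u = v then j else 0
    | Sum.inr u, Sum.inr w => if u = v' ∧ w = v' then Y.idx v' v' - j else Y.idx u w
  col := Sum.elim X.col Y.col
  lab := Sum.elim X.lab Y.lab

/-- `Z` is a concatenation ((i)- or (i,j)-) of `X` and `Y` at `(vX, vY)`. -/
def IsConcatOfAt (Z X Y : EIG V α) (vX : X.Vert) (vY : Y.Vert) : Prop :=
  (∃ i, 1 ≤ i ∧ Nonempty (EIGIso Z (concatI X Y vX vY i))) ∨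
  (∃ i j, 1 ≤ i ∧ 1 ≤ j ∧ Nonempty (EIGIso Z (concatIJ X Y vX vY i j)))

/-! ## Paths, distance, degree in edge-indexed graphs -/

/-- Adjacency (by an edge of positive index, in one of the two orientations). -/
def EIGAdj (X : EIG V α) (u w : X.Vert) : Prop :=
  u ≠ w ∧ (0 < X.idx u w ∨ 0 < X.idx w u)

/-- There is a path of length `L` from `u` to `w`. -/
def EIGReach (X : EIG V α) (u w : X.Vert) (L : ℕ) : Prop :=
  ∃ c : ℕ → X.Vert, c 0 = u ∧ c L = w ∧ ∀ i < L, EIGAdj X (c i) (c (i + 1))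

/-- Graph distance in an edge-indexed graph. -/
def EIGDist (X : EIG V α) (u w : X.Vert) : ℕ :=
  sInf {L | EIGReach X u w L}

/-- `u` has degree one: there is exactly one vertex adjacent to it. -/
def EIGEndVert (X : EIG V α) (u : X.Vert) : Prop :=
  ∃! w, EIGAdj X u w

/-! ## Coverings, direct limits, quotient graph, bounded type -/

/-- `p` exhibits the graph `H` as the universal cover of the edge-indexed graph `Y`:
above a vertex mapping to `u`, the number of neighbors above `w` is the index `idx u w`. -/
def IsEIGCover {W : Type} (H : SimpleGraph W) (Y : EIG V α) (p : W → Y.Vert) : Prop :=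
  ∀ x : W, ∀ u : Y.Vert, (H.neighborSet x ∩ p ⁻¹' {u}).ncard = Y.idx (p x) u

/-- `Y` is the direct limit of the system `F` of colored edge-indexed graphs along the
inclusions `ι`. -/
def IsDirLimit (F : ℕ → EIG V α) (ι : ∀ k, (F k).Vert → (F (k + 1)).Vert)
    (Y : EIG V α) : Prop :=
  ∃ j : ∀ k, (F k).Vert → Y.Vert,
    (∀ k v, j (k + 1) (ι k v) = j k v) ∧
    (∀ k, Function.Injective (j k)) ∧
    (∀ y, ∃ k v, j k v = y) ∧
    (∀ k v, Y.col (j k v) = (F k).col v) ∧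
    (∀ y z : Y.Vert, ∃ N, ∀ k, N ≤ k → ∀ v w, j k v = y → j k w = z →
      Y.idx y z = (F k).idx v w)

/-- The coloring `φ` is of bounded type: every vertex has finite type set. -/
def BoundedType (G : SimpleGraph V) (φ : V → α) : Prop :=
  ∀ v : V, {m : ℕ | IsSpecialVert G φ m v}.Finite

/-- Two vertices are related if some color-preserving automorphism maps one to the other. -/
def colorOrbitRel (G : SimpleGraph V) (φ : V → α) (x y : V) : Prop :=
  ∃ g : V ≃ V, (∀ u w, G.Adj u w ↔ G.Adj (g u) (g w)) ∧ (∀ u, φ (g u) = φ u) ∧ g x = y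

/-- The quotient graph `X_φ = G\T` as a colored edge-indexed graph. -/
def quotEIG (G : SimpleGraph V) (φ : V → α) : EIG V α where
  Vert := Quot (colorOrbitRel G φ)
  idx := fun u w => (G.neighborSet u.out ∩ {z | Quot.mk (colorOrbitRel G φ) z = w}).ncard
  col := fun u => φ u.out
  lab := fun u => {z | Quot.mk (colorOrbitRel G φ) z = u}

/-! ## The sequences `n_k`, `α_k`, `β_k` -/

/-- At level `n`, one of `A_n, B_n` is `S_n` or `C_n`. -/
def SpecTouch (L : Labeling G φ a b) (n : ℕ) : Prop :=
  L.A n = L.S n ∨ L.A n = L.C n ∨ L.B n = L.S n ∨ L.B n = L.C n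

/-- `nk` is the increasing enumeration of the levels where `SpecTouch` holds. -/
def IsNkSeq (L : Labeling G φ a b) (nk : ℕ → ℕ) : Prop :=
  StrictMono nk ∧ ∀ n, (∃ k, nk k = n) ↔ SpecTouch L n

/-- `αs` is the sequence `α_k`: `α_K = A`, and for `k ≠ K`, `α_k` is the side whose
graph `G^{α_k}_{n_k}` has more vertices. -/
def IsAlphaSeq (L : Labeling G φ a b) (nk : ℕ → ℕ) (K : ℕ∞) (αs : ℕ → Bool) : Prop :=
  ∀ k : ℕ, ((k : ℕ∞) = K → αs k = true) ∧
    ((k : ℕ∞) ≠ K → (αs k = true ↔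
      (VGside L (nk k) false).ncard < (VGside L (nk k) true).ncard))

/-- The sequence `β_k(t)`: `β_{k-1}(t)` is the letter `ᾱ_k` if the class of the
`n_k`-ball at `t` is a vertex of `G^{ᾱ_k}_{n_k}`, and `α_k` otherwise. -/
def betaOf (L : Labeling G φ a b) (nk : ℕ → ℕ) (αs : ℕ → Bool) (t : V) (k : ℕ) : Bool :=
  if ballClass G φ (nk (k + 1)) t ∈ VGside L (nk (k + 1)) (!(αs (k + 1))) then
    !(αs (k + 1))
  else αs (k + 1)

end Sturm

namespace Sturm

section

variable {V α : Type} {G : SimpleGraph V}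

/-- A sequence of refining equivalence relations `R n` on the vertices of a connected locally
finite graph, in which exactly one class (that of `s n`) splits at each step, into the classes
of `α (n + 1)` and `β (n + 1)`. -/
structure Refinement (G : SimpleGraph V) (R : ℕ → V → V → Prop) (s c α β : ℕ → V) : Prop where
  conn : G.Connected
  locallyFinite : ∀ v, (G.neighborSet v).Finite
  equiv : ∀ n, Equivalence (R n)
  mono : ∀ n x y, R (n + 1) x y → R n x y
  step : ∀ n x y u, R (n + 1) x y → G.Adj x u → ∃ v, G.Adj y v ∧ R n u v
  refine_of_not_special : ∀ n x y, ¬ R n x (s n) → R n x y → R (n + 1) x y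
  split : ∀ n x, R n x (s n) → R (n + 1) x (α (n + 1)) ∨ R (n + 1) x (β (n + 1))
  base : ∀ x, R 0 x (α 0) ∨ R 0 x (β 0)
  left_special : ∀ n, R n (α (n + 1)) (s n)
  right_special : ∀ n, R n (β (n + 1)) (s n)
  left_ne_right : ∀ n, ¬ R (n + 1) (α (n + 1)) (β (n + 1))
  left_adj : ∀ n x, R (n + 1) x (α (n + 1)) → ∃ y, G.Adj x y ∧ R n y (α n)
  right_adj : ∀ n x, R (n + 1) x (β (n + 1)) → ∃ y, G.Adj x y ∧ R n y (β n)
  central : ∀ n, R n (c n) (s (n + 1))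
  not_covered : ¬ ∃ F : Set V, F.Finite ∧ ∀ x, ∃ f ∈ F, ∀ n, R n x f

/-- The set `U` meets only finitely many classes of the intersection of all the relations. -/
def Covered (R : ℕ → V → V → Prop) (U : Set V) : Prop :=
  ∃ F : Set V, F.Finite ∧ ∀ z ∈ U, ∃ f ∈ F, ∀ n, R n z f

theorem Covered.subset {R : ℕ → V → V → Prop} {U W : Set V} (h : Covered R U) (hWU : W ⊆ U) :
    Covered R W := by
  obtain ⟨F, hF, h⟩ := h
  exact ⟨F, hF, fun z hz => h z (hWU hz)⟩

theorem Covered.union {R : ℕ → V → V → Prop} {U W : Set V} (hU : Covered R U)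
    (hW : Covered R W) : Covered R (U ∪ W) := by
  obtain ⟨F, hF, hU⟩ := hU
  obtain ⟨F', hF', hW⟩ := hW
  refine ⟨F ∪ F', hF.union hF', ?_⟩
  rintro z (hz | hz)
  · obtain ⟨f, hf, h⟩ := hU z hz
    exact ⟨f, Or.inl hf, h⟩
  · obtain ⟨f, hf, h⟩ := hW z hz
    exact ⟨f, Or.inr hf, h⟩

/-- In a connected graph, a set that is neither empty nor everything has a boundary edge. -/
theorem exists_boundary_edge (hG : G.Connected) {P : V → Prop} {x y : V} (hx : P x)
    (hy : ¬ P y) : ∃ u v, G.Adj u v ∧ P u ∧ ¬ P v := by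
  obtain ⟨p⟩ := hG.preconnected x y
  obtain ⟨e, -, h1, h2⟩ := p.exists_boundary_dart {z | P z} hx hy
  exact ⟨e.fst, e.snd, e.adj, h1, h2⟩

/-- A choice of a natural number at each point of a finite set is bounded. -/
theorem exists_bound_of_finite {ι : Type} {F : Set ι} (hF : F.Finite) (N : ι → ℕ) :
    ∃ M, ∀ i ∈ F, N i ≤ M := by
  obtain ⟨M, hM⟩ := (hF.image N).bddAbove
  exact ⟨M, fun i hi => hM ⟨i, hi, rfl⟩⟩

namespace Refinement

variable {R : ℕ → V → V → Prop} {s c α' β' : ℕ → V}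

theorem swap (H : Refinement G R s c α' β') : Refinement G R s c β' α' where
  conn := H.conn
  locallyFinite := H.locallyFinite
  equiv := H.equiv
  mono := H.mono
  step := H.step
  refine_of_not_special := H.refine_of_not_special
  split n x h := (H.split n x h).symm
  base x := (H.base x).symm
  left_special := H.right_special
  right_special := H.left_special
  left_ne_right n h := H.left_ne_right n ((H.equiv _).symm h)
  left_adj := H.right_adj
  right_adj := H.left_adj
  central := H.central
  not_covered := H.not_covered

theorem refl (H : Refinement G R s c α' β') (n : ℕ) (x : V) : R n x x := (H.equiv n).refl x

theorem symm (H : Refinement G R s c α' β') {n : ℕ} {x y : V} (h : R n x y) : R n y x :=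
  (H.equiv n).symm h

theorem trans (H : Refinement G R s c α' β') {n : ℕ} {x y z : V} (h : R n x y)
    (h' : R n y z) : R n x z :=
  (H.equiv n).trans h h'

theorem anti (H : Refinement G R s c α' β') {m n : ℕ} (hmn : m ≤ n) {x y : V}
    (h : R n x y) : R m x y := by
  induction hmn with
  | refl => exact h
  | step _ ih => exact ih (H.mono _ _ _ h)

/-- Neighbors of a class that is not special exist uniformly over the class. -/
theorem adj_of_not_special (H : Refinement G R s c α' β') {n : ℕ} {x x' y : V}
    (hx : ¬ R n x (s n)) (h : R n x x') (hxy : G.Adj x y) : ∃ y', G.Adj x' y' ∧ R n y y' :=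
  H.step n x x' y (H.refine_of_not_special n x x' hx h) hxy

/-- Neighbors in a class other than those of `α n` and `β n` exist uniformly. -/
theorem adj_of_ne (H : Refinement G R s c α' β') {n : ℕ} {x x' y : V}
    (hα : ¬ R n y (α' n)) (hβ : ¬ R n y (β' n)) (h : R n x x') (hxy : G.Adj x y) :
    ∃ y', G.Adj x' y' ∧ R n y y' := by
  cases n with
  | zero => exact absurd (H.base y) (by tauto)
  | succ k =>
    obtain ⟨y', h1, h2⟩ := H.step k x x' y h hxy
    refine ⟨y', h1, H.refine_of_not_special k y y' (fun hs => ?_) h2⟩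
    exact absurd (H.split k y hs) (by tauto)

/-- A class that is special neither at level `n` nor at level `n + 1` has uniform neighbors at
level `n + 1`. -/
theorem adj_succ_of_not_special (H : Refinement G R s c α' β') {n : ℕ} {x x' y : V}
    (hx : ¬ R n x (s n)) (hc : ¬ R n x (c n)) (h : R n x x') (hxy : G.Adj x y) :
    ∃ y', G.Adj x' y' ∧ R (n + 1) y y' := by
  refine H.adj_of_not_special (fun hs => hc ?_) (H.refine_of_not_special n x x' hx h) hxy
  exact H.trans (H.mono _ _ _ hs) (H.symm (H.central n))

theorem exists_finite_reps (H : Refinement G R s c α' β') (n : ℕ) :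
    ∃ F : Set V, F.Finite ∧ ∀ x, ∃ f ∈ F, R n x f := by
  induction n with
  | zero =>
    refine ⟨{α' 0, β' 0}, Set.toFinite _, fun x => ?_⟩
    rcases H.base x with h | h
    · exact ⟨_, by simp, h⟩
    · exact ⟨_, by simp, h⟩
  | succ n ih =>
    obtain ⟨F, hF, h⟩ := ih
    refine ⟨F ∪ {α' (n + 1), β' (n + 1)}, hF.union (Set.toFinite _), fun x => ?_⟩
    by_cases hs : R n x (s n)
    · rcases H.split n x hs with h | h
      · exact ⟨_, by simp, h⟩
      · exact ⟨_, by simp, h⟩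
    · obtain ⟨f, hf, hxf⟩ := h x
      exact ⟨f, Or.inl hf, H.refine_of_not_special n x f hs hxf⟩

theorem covered_of_adj (H : Refinement G R s c α' β') {U W : Set V} (hW : Covered R W)
    (h : ∀ u ∈ U, ∃ y ∈ W, G.Adj u y) : Covered R U := by
  obtain ⟨F, hF, hW⟩ := hW
  refine ⟨⋃ f ∈ F, G.neighborSet f, hF.biUnion fun f _ => H.locallyFinite f, fun z hz => ?_⟩
  obtain ⟨y, hy, hzy⟩ := h z hz
  obtain ⟨f, hf, hyf⟩ := hW y hy
  have key : ∃ w ∈ G.neighborSet f, ∀ n, R n z w := by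
    by_contra! hcon
    choose! N hN using hcon
    obtain ⟨M, hM⟩ := exists_bound_of_finite (H.locallyFinite f) N
    obtain ⟨w, hw, hzw⟩ := H.step M y f z (hyf _) hzy.symm
    exact hN w hw (H.anti (hM w hw) hzw)
  obtain ⟨w, hw, hzw⟩ := key
  exact ⟨w, Set.mem_biUnion hf hw, hzw⟩

theorem not_covered_univ (H : Refinement G R s c α' β') : ¬ Covered R (Set.univ : Set V) :=
  fun ⟨F, hF, h⟩ => H.not_covered ⟨F, hF, fun x => h x trivial⟩

theorem exists_not_covered (H : Refinement G R s c α' β') (n : ℕ) :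
    ∃ x, ¬ Covered R {z | R n x z} := by
  by_contra! hcon
  choose F hF hcov using hcon
  obtain ⟨E, hE, hrep⟩ := H.exists_finite_reps n
  refine H.not_covered ⟨⋃ e ∈ E, F e, hE.biUnion fun e _ => hF e, fun x => ?_⟩
  obtain ⟨e, he, hxe⟩ := hrep x
  obtain ⟨f, hf, h⟩ := hcov e x (H.symm hxe)
  exact ⟨f, Set.mem_biUnion he hf, h⟩

theorem special_of_boundary (H : Refinement G R s c α' β') {n : ℕ} {x y : V}
    (hx : Covered R {z | R n x z}) (hy : ¬ Covered R {z | R n y z}) (hxy : G.Adj x y) :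
    R n y (s n) := by
  by_contra hs
  refine hy (H.covered_of_adj hx fun u hu => ?_)
  obtain ⟨x', h1, h2⟩ := H.adj_of_not_special hs hu hxy.symm
  exact ⟨x', h2, h1⟩

theorem covered_succ_of_adj (H : Refinement G R s c α' β') {n : ℕ} {x y : V}
    (hx : Covered R {z | R n x z}) (hxy : G.Adj x y) : Covered R {z | R (n + 1) y z} := by
  refine H.covered_of_adj hx fun u hu => ?_
  obtain ⟨x', h1, h2⟩ := H.step n y u x hu hxy.symm
  exact ⟨x', h2, h1⟩

theorem not_special_of_covered (H : Refinement G R s c α' β') {n : ℕ} {x : V}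
    (hx : Covered R {z | R n x z}) : ¬ R n x (s n) := by
  intro hs
  obtain ⟨w, hw⟩ := H.exists_not_covered n
  obtain ⟨u, v, huv, hu, hv⟩ :=
    exists_boundary_edge H.conn (P := fun x => Covered R {z | R n x z}) hx hw
  have hvs := H.special_of_boundary hu hv huv
  exact hv (hx.subset fun z hz => H.trans (H.trans hs (H.symm hvs)) hz)

theorem forall_of_covered (H : Refinement G R s c α' β') {n : ℕ} {x y : V}
    (hx : Covered R {z | R n x z}) (hxy : R n x y) (m : ℕ) : R m x y := by
  rcases le_total m n with hmn | hmn
  · exact H.anti hmn hxy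
  · induction hmn with
    | refl => exact hxy
    | step hm ih =>
      refine H.refine_of_not_special _ _ _ (H.not_special_of_covered ?_) ih
      exact hx.subset fun z hz => H.anti hm hz

/-- Two vertices whose classes become covered at the same level have the same class at
every level. -/
theorem forall_of_first_covered (H : Refinement G R s c α' β') {n : ℕ} {x y : V}
    (hx : Covered R {z | R n x z}) (hy : Covered R {z | R n y z})
    (hx' : ∀ m < n, ¬ Covered R {z | R m x z}) (hy' : ∀ m < n, ¬ Covered R {z | R m y z})
    (m : ℕ) : R m x y := by
  refine H.forall_of_covered hx ?_ m
  by_contra hxy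
  cases n with
  | zero =>
    refine H.not_covered_univ ((hx.union hy).subset fun z _ => ?_)
    have h1 := H.base x
    have h2 := H.base y
    have h3 := H.base z
    rcases h1 with h1 | h1 <;> rcases h2 with h2 | h2 <;> rcases h3 with h3 | h3
    all_goals first
      | exact absurd (H.trans h1 (H.symm h2)) hxy
      | exact Or.inl (H.trans h1 (H.symm h3))
      | exact Or.inr (H.trans h2 (H.symm h3))
  | succ k =>
    have special : ∀ w, Covered R {z | R (k + 1) w z} → ¬ Covered R {z | R k w z} →
        R k w (s k) := by
      intro w hw hw'
      by_contra hs
      exact hw' (hw.subset fun z hz => H.refine_of_not_special k w z hs hz)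
    have hxs := special x hx (hx' k k.lt_succ_self)
    have hys := special y hy (hy' k k.lt_succ_self)
    refine hx' k k.lt_succ_self ((hx.union hy).subset fun z hz => ?_)
    have hzs : R k z (s k) := H.trans (H.symm hz) hxs
    have h1 := H.split k x hxs
    have h2 := H.split k y hys
    have h3 := H.split k z hzs
    rcases h1 with h1 | h1 <;> rcases h2 with h2 | h2 <;> rcases h3 with h3 | h3
    all_goals first
      | exact absurd (H.trans h1 (H.symm h2)) hxy
      | exact Or.inl (H.trans h1 (H.symm h3))
      | exact Or.inr (H.trans h2 (H.symm h3))

theorem no_three_neighbors_of_covered (H : Refinement G R s c α' β') {N : ℕ} {x₀ : V}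
    (h₀ : Covered R {z | R N x₀ z}) {n : ℕ} {x y₁ y₂ y₃ : V}
    (h₁ : G.Adj x y₁) (h₂ : G.Adj x y₂) (h₃ : G.Adj x y₃)
    (hx₁ : ¬ R n x y₁) (hx₂ : ¬ R n x y₂) (hx₃ : ¬ R n x y₃)
    (h₁₂ : ¬ R n y₁ y₂) (h₁₃ : ¬ R n y₁ y₃) (h₂₃ : ¬ R n y₂ y₃) : False := by
  have hall : ∀ w, ∃ m, Covered R {z | R m w z} := by
    by_contra! hcon
    obtain ⟨w, hw⟩ := hcon
    obtain ⟨u, v, huv, ⟨m, hu⟩, hv⟩ := exists_boundary_edge H.conn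
      (P := fun w => ∃ m, Covered R {z | R m w z}) ⟨N, h₀⟩ (not_exists.2 hw)
    exact hv ⟨m + 1, H.covered_succ_of_adj hu huv⟩
  let ρ : V → ℕ := fun w => Nat.find (hall w)
  have hρ_adj : ∀ u v, G.Adj u v → ρ v ≤ ρ u + 1 := fun u v huv =>
    Nat.find_min' (hall v) (H.covered_succ_of_adj (Nat.find_spec (hall u)) huv)
  have hρ_eq : ∀ u v, ρ u = ρ v → R n u v := fun u v huv => by
    have hv := Nat.find_spec (hall v)
    have hv' : ∀ m < ρ v, ¬ Covered R {z | R m v z} := fun m hm => Nat.find_min (hall v) hm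
    change Covered R {z | R (ρ v) v z} at hv
    rw [← huv] at hv hv'
    exact H.forall_of_first_covered (Nat.find_spec (hall u)) hv
      (fun m hm => Nat.find_min (hall u) hm) hv' n
  have a₁ := hρ_adj _ _ h₁
  have a₂ := hρ_adj _ _ h₂
  have a₃ := hρ_adj _ _ h₃
  have b₁ := hρ_adj _ _ h₁.symm
  have b₂ := hρ_adj _ _ h₂.symm
  have b₃ := hρ_adj _ _ h₃.symm
  have e₁ := mt (hρ_eq _ _) hx₁
  have e₂ := mt (hρ_eq _ _) hx₂
  have e₃ := mt (hρ_eq _ _) hx₃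
  have f₁ := mt (hρ_eq _ _) h₁₂
  have f₂ := mt (hρ_eq _ _) h₁₃
  have f₃ := mt (hρ_eq _ _) h₂₃
  omega

theorem exists_special_ge (H : Refinement G R s c α' β') {x : V} {n : ℕ}
    (hx : ¬ Covered R {z | R n x z}) : ∃ m, n ≤ m ∧ R m x (s m) := by
  by_contra! hcon
  refine hx ⟨{x}, Set.finite_singleton x, fun z hz => ⟨x, rfl, fun m => H.symm ?_⟩⟩
  rcases le_total m n with hmn | hmn
  · exact H.anti hmn hz
  · induction hmn with
    | refl => exact hz
    | step hm ih => exact H.refine_of_not_special _ _ _ (hcon _ hm) ih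

/-- From some level on, the neighbors of `y` are not separated any further. -/
theorem exists_stable_level (H : Refinement G R s c α' β') (y : V) :
    ∃ M, ∀ u v, G.Adj y u → G.Adj y v → R M u v → ∀ m, R m u v := by
  have h : ∀ p : V × V, ∃ N, R N p.1 p.2 → ∀ m, R m p.1 p.2 := fun p => by
    by_contra! hcon
    obtain ⟨-, m, hm⟩ := hcon 0
    exact hm (hcon m).1
  choose N hN using h
  obtain ⟨M, hM⟩ := exists_bound_of_finite ((H.locallyFinite y).prod (H.locallyFinite y)) N
  exact ⟨M, fun u v hu hv huv => hN (u, v) (H.anti (hM (u, v) ⟨hu, hv⟩) huv)⟩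

/-- At a stable level, every neighbor class of the special class at a vertex of the class of
`α' (m + 1)` is the central class or that of `α' m`. -/
theorem neighbor_of_stable (H : Refinement G R s c α' β') {m : ℕ} {x y : V}
    (hx : R (m + 1) x (α' (m + 1))) (hxy : G.Adj x y) (hy : ¬ R m x y)
    (hstab : ∀ u v, G.Adj y u → G.Adj y v → R m u v → ∀ k, R k u v) :
    R m y (c m) ∨ R m y (α' m) := by
  by_contra! hcon
  obtain ⟨hc, hα⟩ := hcon
  have hxs : R m x (s m) := H.trans (H.mono _ _ _ hx) (H.left_special m)
  have hys : ¬ R m y (s m) := fun h => hy (H.trans hxs (H.symm h))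
  obtain ⟨y', hy'adj, hyy'⟩ : ∃ y', G.Adj (β' (m + 1)) y' ∧ R m y y' := by
    by_cases hβ : R m y (β' m)
    · obtain ⟨y', h1, h2⟩ := H.right_adj m _ (H.refl _ (β' (m + 1)))
      exact ⟨y', h1, H.trans hβ (H.symm h2)⟩
    · exact H.adj_of_ne hα hβ (H.trans hxs (H.symm (H.right_special m))) hxy
  have hy's : ¬ R m y' (s m) := fun h => hys (H.trans hyy' h)
  have hy'c : ¬ R m y' (c m) := fun h => hc (H.trans hyy' h)
  obtain ⟨z, hyz, hz⟩ := H.adj_succ_of_not_special hy's hy'c (H.symm hyy') hy'adj.symm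
  have hxz := hstab x z hxy.symm hyz
    (H.trans hxs (H.trans (H.symm (H.right_special m)) (H.mono _ _ _ hz))) (m + 1)
  exact H.left_ne_right m (H.trans (H.symm hx) (H.trans hxz (H.symm hz)))

/-- A vertex has neighbors in at most two classes other than its own. -/
theorem no_three_neighbors (H : Refinement G R s c α' β') {n : ℕ} {x y₁ y₂ y₃ : V}
    (h₁ : G.Adj x y₁) (h₂ : G.Adj x y₂) (h₃ : G.Adj x y₃)
    (hx₁ : ¬ R n x y₁) (hx₂ : ¬ R n x y₂) (hx₃ : ¬ R n x y₃)
    (h₁₂ : ¬ R n y₁ y₂) (h₁₃ : ¬ R n y₁ y₃) (h₂₃ : ¬ R n y₂ y₃) : False := by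
  by_cases hcov : ∃ N x₀, Covered R {z | R N x₀ z}
  · obtain ⟨N, x₀, h₀⟩ := hcov
    exact H.no_three_neighbors_of_covered h₀ h₁ h₂ h₃ hx₁ hx₂ hx₃ h₁₂ h₁₃ h₂₃
  push Not at hcov
  obtain ⟨M₁, hM₁⟩ := H.exists_stable_level y₁
  obtain ⟨M₂, hM₂⟩ := H.exists_stable_level y₂
  obtain ⟨M₃, hM₃⟩ := H.exists_stable_level y₃
  obtain ⟨m, hm, hs⟩ := H.exists_special_ge (hcov (n + M₁ + M₂ + M₃) x)
  have lift : ∀ {u v}, ¬ R n u v → ¬ R m u v := fun h h' => h (H.anti (by omega) h')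
  have main : ∀ {γ δ : ℕ → V}, Refinement G R s c γ δ → R (m + 1) x (γ (m + 1)) → False := by
    intro γ δ K hx
    have e₁ := K.neighbor_of_stable hx h₁ (lift hx₁)
      fun u v hu hv h => hM₁ u v hu hv (H.anti (by omega) h)
    have e₂ := K.neighbor_of_stable hx h₂ (lift hx₂)
      fun u v hu hv h => hM₂ u v hu hv (H.anti (by omega) h)
    have e₃ := K.neighbor_of_stable hx h₃ (lift hx₃)
      fun u v hu hv h => hM₃ u v hu hv (H.anti (by omega) h)
    have same : ∀ {u v w}, R m u w → R m v w → R m u v := fun h h' => H.trans h (H.symm h')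
    have g₁₂ := lift h₁₂
    have g₁₃ := lift h₁₃
    have g₂₃ := lift h₂₃
    rcases e₁ with e₁ | e₁ <;> rcases e₂ with e₂ | e₂ <;> rcases e₃ with e₃ | e₃
    all_goals first
      | exact g₁₂ (same e₁ e₂)
      | exact g₁₃ (same e₁ e₃)
      | exact g₂₃ (same e₂ e₃)
  rcases H.split m x hs with h | h
  · exact main H h
  · exact main H.swap h

/-- A vertex `y` next to the special class, whose class is none of the distinguished ones, is
next to no other class. -/
theorem neighbor_of_undistinguished (H : Refinement G R s c α' β') {n : ℕ} {x y w : V}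
    (hxs : R n x (s n)) (hxy : G.Adj x y) (hs : ¬ R n y (s n)) (hα : ¬ R n y (α' n))
    (hβ : ¬ R n y (β' n)) (hc : ¬ R n y (c n)) (hyw : G.Adj y w) :
    R n y w ∨ R n w (s n) := by
  have key : ∀ p, R n p (s n) → ∃ q, G.Adj y q ∧ R (n + 1) p q := by
    intro p hp
    obtain ⟨y', h1, h2⟩ := H.adj_of_ne hα hβ (H.trans hxs (H.symm hp)) hxy
    exact H.adj_succ_of_not_special (fun h => hs (H.trans h2 h)) (fun h => hc (H.trans h2 h))
      (H.symm h2) h1.symm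
  obtain ⟨p, hyp, hp⟩ := key _ (H.left_special n)
  obtain ⟨q, hyq, hq⟩ := key _ (H.right_special n)
  have hps : R n p (s n) := H.trans (H.symm (H.mono _ _ _ hp)) (H.left_special n)
  have hqs : R n q (s n) := H.trans (H.symm (H.mono _ _ _ hq)) (H.right_special n)
  by_contra! hcon
  obtain ⟨hw, hws⟩ := hcon
  refine H.no_three_neighbors (n := n + 1) hyp hyq hyw ?_ ?_ ?_ ?_ ?_ ?_
  · exact fun h => hs (H.trans (H.mono _ _ _ h) hps)
  · exact fun h => hs (H.trans (H.mono _ _ _ h) hqs)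
  · exact fun h => hw (H.mono _ _ _ h)
  · exact fun h => H.left_ne_right n (H.trans hp (H.trans h (H.symm hq)))
  · exact fun h => hws (H.trans (H.symm (H.mono _ _ _ h)) hps)
  · exact fun h => hws (H.trans (H.symm (H.mono _ _ _ h)) hqs)

/-- If the special class has an undistinguished neighbor and is not central, then
`α' n` is special or central. -/
theorem left_eq_of_undistinguished (H : Refinement G R s c α' β') {n : ℕ} {x y : V}
    (hxs : R n x (s n)) (hxy : G.Adj x y) (hs : ¬ R n y (s n)) (hα : ¬ R n y (α' n))
    (hβ : ¬ R n y (β' n)) (hc : ¬ R n y (c n)) (hcs : ¬ R n (c n) (s n)) :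
    R n (α' n) (s n) ∨ R n (α' n) (c n) := by
  by_contra! hcon
  obtain ⟨hαs, hαc⟩ := hcon
  obtain ⟨p, h1, h2⟩ := H.left_adj (n + 1) _ (H.refl _ (α' (n + 2)))
  have hpn : R n p (s n) := H.trans (H.mono _ _ _ h2) (H.left_special n)
  obtain ⟨u, hu, hu'⟩ := H.left_adj n p h2
  obtain ⟨v, hv, hv'⟩ := H.adj_of_ne hα hβ (H.trans hxs (H.symm hpn)) hxy
  have hwc : R n (α' (n + 2)) (c n) :=
    H.trans (H.mono _ _ _ (H.left_special (n + 1))) (H.symm (H.central n))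
  refine H.no_three_neighbors (n := n) h1.symm hu hv ?_ ?_ ?_ ?_ ?_ ?_
  · exact fun h => hcs (H.trans (H.symm hwc) (H.trans (H.symm h) hpn))
  · exact fun h => hαs (H.trans (H.symm hu') (H.trans (H.symm h) hpn))
  · exact fun h => hs (H.trans hv' (H.trans (H.symm h) hpn))
  · exact fun h => hαc (H.trans (H.symm hu') (H.trans (H.symm h) hwc))
  · exact fun h => hc (H.trans hv' (H.trans (H.symm h) hwc))
  · exact fun h => hα (H.trans hv' (H.trans (H.symm h) hu'))

/-- If the special class has an undistinguished neighbor and `α' (n + 1)` is special, then so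
is `β' n`. -/
theorem right_special_of_undistinguished (H : Refinement G R s c α' β') {n : ℕ} {x y : V}
    (hxs : R n x (s n)) (hxy : G.Adj x y) (hs : ¬ R n y (s n)) (hα : ¬ R n y (α' n))
    (hβ : ¬ R n y (β' n)) (hsα : R (n + 1) (s (n + 1)) (α' (n + 1))) :
    R n (β' n) (s n) := by
  by_contra hβs
  obtain ⟨q, h1, h2⟩ := H.right_adj (n + 1) _ (H.refl _ (β' (n + 2)))
  have hqn : R n q (s n) := H.trans (H.mono _ _ _ h2) (H.right_special n)
  obtain ⟨u, hu, hu'⟩ := H.right_adj n q h2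
  obtain ⟨v, hv, hv'⟩ := H.adj_of_ne hα hβ (H.trans hxs (H.symm hqn)) hxy
  have hw : R (n + 1) (β' (n + 2)) (α' (n + 1)) := H.trans (H.right_special (n + 1)) hsα
  have hwn : R n (β' (n + 2)) (s n) := H.trans (H.mono _ _ _ hw) (H.left_special n)
  refine H.no_three_neighbors (n := n + 1) h1.symm hu hv ?_ ?_ ?_ ?_ ?_ ?_
  · exact fun h => H.left_ne_right n (H.trans (H.symm hw) (H.trans (H.symm h) h2))
  · exact fun h => hβs (H.trans (H.symm hu') (H.trans (H.symm (H.mono _ _ _ h)) hqn))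
  · exact fun h => hs (H.trans hv' (H.trans (H.symm (H.mono _ _ _ h)) hqn))
  · exact fun h => hβs (H.trans (H.symm hu') (H.trans (H.symm (H.mono _ _ _ h)) hwn))
  · exact fun h => hs (H.trans hv' (H.trans (H.symm (H.mono _ _ _ h)) hwn))
  · exact fun h => hβ (H.trans hv' (H.trans (H.symm (H.mono _ _ _ h)) hu'))

/-- If the special class has an undistinguished neighbor, then at most one of the classes of
`α' n`, `β' n`, `c n` is not special. -/
theorem distinguished_unique (H : Refinement G R s c α' β') {n : ℕ} {x y : V}
    (hxs : R n x (s n)) (hxy : G.Adj x y) (hs : ¬ R n y (s n)) (hα : ¬ R n y (α' n))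
    (hβ : ¬ R n y (β' n)) (hc : ¬ R n y (c n)) {u v : V}
    (hu : R n u (α' n) ∨ R n u (β' n) ∨ R n u (c n)) (hus : ¬ R n u (s n))
    (hv : R n v (α' n) ∨ R n v (β' n) ∨ R n v (c n)) (hvs : ¬ R n v (s n)) : R n u v := by
  obtain ⟨t, ht⟩ : ∃ t, ∀ w, (R n w (α' n) ∨ R n w (β' n) ∨ R n w (c n)) →
      R n w (s n) ∨ R n w t := by
    by_cases hcs : R n (c n) (s n)
    · have hsn : R n (s (n + 1)) (s n) := H.trans (H.symm (H.central n)) hcs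
      rcases H.split n _ hsn with h | h
      · have := H.right_special_of_undistinguished hxs hxy hs hα hβ h
        refine ⟨α' n, ?_⟩
        rintro w (hw | hw | hw)
        · exact Or.inr hw
        · exact Or.inl (H.trans hw this)
        · exact Or.inl (H.trans hw hcs)
      · have := H.swap.right_special_of_undistinguished hxs hxy hs hβ hα h
        refine ⟨β' n, ?_⟩
        rintro w (hw | hw | hw)
        · exact Or.inl (H.trans hw this)
        · exact Or.inr hw
        · exact Or.inl (H.trans hw hcs)
    · have h1 := H.left_eq_of_undistinguished hxs hxy hs hα hβ hc hcs
      have h2 := H.swap.left_eq_of_undistinguished hxs hxy hs hβ hα hc hcs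
      refine ⟨c n, ?_⟩
      rintro w (hw | hw | hw)
      · exact h1.imp (H.trans hw) (H.trans hw)
      · exact h2.imp (H.trans hw) (H.trans hw)
      · exact Or.inr hw
  exact H.trans ((ht u hu).resolve_left hus) (H.symm ((ht v hv).resolve_left hvs))

end Refinement

/-- If a refinement of an equivalence relation has exactly one class more, and splits the class
of `y`, then it splits the rest of that class no further, and no other class at all. -/
theorem rel_of_ncard_classes {r r' : V → V → Prop} (hr : Equivalence r) (hr' : Equivalence r')
    (hle : ∀ x y, r' x y → r x y) {m : ℕ}
    (hm : {C : Set V | ∃ x, C = {y | r x y}}.ncard = m + 1)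
    (hm' : {C : Set V | ∃ x, C = {y | r' x y}}.ncard = m + 2)
    {x y u v : V} (hxy : r x y) (hxy' : ¬ r' x y) (hu : ¬ r' u y) (hv : ¬ r' v y)
    (huv : r u v) : r' u v := by
  have mem : ∀ w, ¬ r' w y →
      {z | r' w z} ∈ {C : Set V | ∃ x, C = {y | r' x y}} \ {{z | r' y z}} := by
    refine fun w hw => ⟨⟨w, rfl⟩, fun h => hw ?_⟩
    have : y ∈ {z | r' w z} := by rw [h]; exact hr'.refl y
    exact this
  have hfin : {C : Set V | ∃ x, C = {y | r' x y}}.Finite :=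
    Set.finite_of_ncard_pos (by omega)
  have himg : ∀ w, {z | ∃ t ∈ {t | r' w t}, r t z} = {z | r w z} := by
    intro w
    ext z
    constructor
    · rintro ⟨t, ht, htz⟩
      exact hr.trans (hle _ _ ht) htz
    · exact fun h => ⟨w, hr'.refl w, h⟩
  let h : Set V → Set V := fun D => {z | ∃ t ∈ D, r t z}
  have himage : h '' ({C : Set V | ∃ x, C = {y | r' x y}} \ {{z | r' y z}}) =
      {C : Set V | ∃ x, C = {y | r x y}} := by
    ext C
    constructor
    · rintro ⟨D, ⟨⟨w, rfl⟩, -⟩, rfl⟩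
      exact ⟨w, himg w⟩
    · rintro ⟨w, rfl⟩
      by_cases hw : r' w y
      · refine ⟨_, mem x hxy', (himg x).trans ?_⟩
        have hxw := hr.trans hxy (hr.symm (hle _ _ hw))
        ext z
        exact ⟨fun hz => hr.trans (hr.symm hxw) hz, fun hz => hr.trans hxw hz⟩
      · exact ⟨_, mem w hw, himg w⟩
  have hinj : Set.InjOn h ({C : Set V | ∃ x, C = {y | r' x y}} \ {{z | r' y z}}) := by
    refine Set.injOn_of_ncard_image_eq ?_ hfin.sdiff
    have hy : {z | r' y z} ∈ {C : Set V | ∃ x, C = {y | r' x y}} := ⟨y, rfl⟩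
    rw [himage, hm, Set.ncard_sdiff_singleton_of_mem hy, hm']
    rfl
  have heq : {z | r' u z} = {z | r' v z} := by
    refine hinj (mem u hu) (mem v hv) ((himg u).trans (Eq.trans ?_ (himg v).symm))
    ext z
    exact ⟨fun hz => hr.trans (hr.symm huv) hz, fun hz => hr.trans huv hz⟩
  have : v ∈ {z | r' u z} := by rw [heq]; exact hr'.refl v
  exact this

namespace BallEquiv

variable {φ : V → α}

theorem equivalence (n : ℕ) : Equivalence (BallEquiv G φ n) where
  refl x := ⟨Equiv.refl _, fun _ _ => Iff.rfl, fun _ => rfl, rfl⟩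
  symm := by
    rintro x y ⟨f, hadj, hcol, hx⟩
    refine ⟨f.symm, fun u v => ?_, fun u => ?_, ?_⟩
    · rw [hadj, f.apply_symm_apply, f.apply_symm_apply]
    · rw [← hcol, f.apply_symm_apply]
    · have : f.symm ⟨y, by rw [SimpleGraph.dist_self]; exact Nat.zero_le n⟩ =
          ⟨x, by rw [SimpleGraph.dist_self]; exact Nat.zero_le n⟩ := by
        rw [Equiv.symm_apply_eq]
        exact Subtype.ext hx.symm
      rw [this]
  trans := by
    rintro x y z ⟨f, hadj, hcol, hx⟩ ⟨g, hadj', hcol', hy⟩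
    refine ⟨f.trans g, fun u v => (hadj u v).trans (hadj' _ _),
      fun u => (hcol' _).trans (hcol u), ?_⟩
    have : f ⟨x, by rw [SimpleGraph.dist_self]; exact Nat.zero_le n⟩ =
        ⟨y, by rw [SimpleGraph.dist_self]; exact Nat.zero_le n⟩ := Subtype.ext hx
    rw [Equiv.trans_apply, this, hy]

/-- A map between balls that preserves adjacency does not lengthen walks that cannot leave
the ball. -/
theorem dist_map_le_length (hG : G.Connected) {N : ℕ} {x y : V}
    (f : {z : V // G.dist x z ≤ N} → {z : V // G.dist y z ≤ N})
    (hf : ∀ u v, G.Adj u.1 v.1 → G.Adj (f u).1 (f v).1) {p z : V} (q : G.Walk p z)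
    (hp : G.dist x p ≤ N) (hz : G.dist x z ≤ N) (hq : G.dist x p + q.length ≤ N) :
    G.dist (f ⟨p, hp⟩).1 (f ⟨z, hz⟩).1 ≤ q.length := by
  induction q with
  | nil => simp
  | @cons p w z h q ih =>
    have hxw : G.dist x w ≤ G.dist x p + 1 :=
      (hG.dist_triangle (v := p)).trans (by rw [SimpleGraph.dist_eq_one_iff_adj.2 h])
    rw [SimpleGraph.Walk.length_cons] at hq ⊢
    have hw : G.dist x w ≤ N := by omega
    have h1 := ih hw hz (by omega)
    have h2 := SimpleGraph.dist_eq_one_iff_adj.2 (hf ⟨p, hp⟩ ⟨w, hw⟩ h)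
    have h3 := hG.dist_triangle (u := (f ⟨p, hp⟩).1) (v := (f ⟨w, hw⟩).1) (w := (f ⟨z, hz⟩).1)
    omega

theorem dist_map_le (hG : G.Connected) {N : ℕ} {x y : V}
    (f : {z : V // G.dist x z ≤ N} → {z : V // G.dist y z ≤ N})
    (hf : ∀ u v, G.Adj u.1 v.1 → G.Adj (f u).1 (f v).1) (p z : {z : V // G.dist x z ≤ N})
    (h : G.dist x p.1 + G.dist p.1 z.1 ≤ N) :
    G.dist (f p).1 (f z).1 ≤ G.dist p.1 z.1 := by
  obtain ⟨q, hq⟩ := hG.exists_walk_length_eq_dist p.1 z.1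
  rw [← hq] at h ⊢
  exact dist_map_le_length hG f hf q p.2 z.2 h

/-- An equivalence of balls restricts to an equivalence of smaller balls inside them. -/
theorem restrict (hG : G.Connected) {N : ℕ} {x y : V}
    (f : {z : V // G.dist x z ≤ N} ≃ {z : V // G.dist y z ≤ N})
    (hadj : ∀ u v : {z : V // G.dist x z ≤ N}, G.Adj u.1 v.1 ↔ G.Adj (f u).1 (f v).1)
    (hcol : ∀ u : {z : V // G.dist x z ≤ N}, φ (f u).1 = φ u.1)
    (hx : (f ⟨x, by rw [SimpleGraph.dist_self]; exact Nat.zero_le N⟩).1 = y)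
    (p : {z : V // G.dist x z ≤ N}) {k : ℕ} (hk : G.dist x p.1 + k ≤ N) :
    BallEquiv G φ k p.1 (f p).1 := by
  have hadj' : ∀ u v : {z : V // G.dist y z ≤ N},
      G.Adj u.1 v.1 → G.Adj (f.symm u).1 (f.symm v).1 := fun u v h => by
    rwa [hadj, f.apply_symm_apply, f.apply_symm_apply]
  have hfp : G.dist y (f p).1 ≤ G.dist x p.1 := by
    have := dist_map_le hG f (fun u v => (hadj u v).1)
      ⟨x, by rw [SimpleGraph.dist_self]; exact Nat.zero_le N⟩ p
      (by dsimp only; rw [SimpleGraph.dist_self, zero_add]; exact p.2)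
    rwa [hx] at this
  have mem : ∀ z, G.dist p.1 z ≤ k → G.dist x z ≤ N := fun z hz =>
    (hG.dist_triangle (v := p.1)).trans (by omega)
  have mem' : ∀ z, G.dist (f p).1 z ≤ k → G.dist y z ≤ N := fun z hz =>
    (hG.dist_triangle (v := (f p).1)).trans (by omega)
  refine ⟨⟨fun z => ⟨(f ⟨z.1, mem z.1 z.2⟩).1, ?_⟩,
    fun z => ⟨(f.symm ⟨z.1, mem' z.1 z.2⟩).1, ?_⟩, fun z => ?_, fun z => ?_⟩,
    fun u v => hadj ⟨u.1, mem u.1 u.2⟩ ⟨v.1, mem v.1 v.2⟩,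
    fun u => hcol ⟨u.1, mem u.1 u.2⟩, rfl⟩
  · have hz := z.2
    exact (dist_map_le hG f (fun u v => (hadj u v).1) p ⟨z.1, mem z.1 hz⟩
      (by dsimp only; omega)).trans hz
  · have hz := z.2
    have := dist_map_le hG f.symm hadj' (f p) ⟨z.1, mem' z.1 hz⟩ (by dsimp only; omega)
    rw [f.symm_apply_apply] at this
    exact this.trans hz
  · simp
  · simp

theorem of_succ (hG : G.Connected) {n : ℕ} {x y : V} (h : BallEquiv G φ (n + 1) x y) :
    BallEquiv G φ n x y := by
  obtain ⟨f, hadj, hcol, hx⟩ := h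
  have := restrict hG f hadj hcol hx
    ⟨x, by rw [SimpleGraph.dist_self]; exact Nat.zero_le _⟩ (k := n)
    (by rw [SimpleGraph.dist_self]; omega)
  rwa [hx] at this

theorem exists_adj (hG : G.Connected) {n : ℕ} {x y u : V} (h : BallEquiv G φ (n + 1) x y)
    (hxu : G.Adj x u) : ∃ v, G.Adj y v ∧ BallEquiv G φ n u v := by
  obtain ⟨f, hadj, hcol, hx⟩ := h
  have hu : G.dist x u = 1 := SimpleGraph.dist_eq_one_iff_adj.2 hxu
  have hu' : G.dist x u ≤ n + 1 := by omega
  refine ⟨(f ⟨u, hu'⟩).1, ?_, restrict hG f hadj hcol hx ⟨u, hu'⟩ (by dsimp only; omega)⟩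
  have := (hadj ⟨x, by rw [SimpleGraph.dist_self]; exact Nat.zero_le _⟩ ⟨u, hu'⟩).1 hxu
  rwa [hx] at this

theorem color_eq {n : ℕ} {x y : V} (h : BallEquiv G φ n x y) : φ x = φ y := by
  obtain ⟨f, -, hcol, hx⟩ := h
  have := hcol ⟨x, by rw [SimpleGraph.dist_self]; exact Nat.zero_le _⟩
  rw [hx] at this
  exact this.symm

theorem ballClass_eq_iff {n : ℕ} {x y : V} :
    ballClass G φ n x = ballClass G φ n y ↔ BallEquiv G φ n x y := by
  constructor
  · intro h
    have : y ∈ ballClass G φ n x := by rw [h]; exact (equivalence n).refl y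
    exact this
  · intro h
    ext z
    exact ⟨fun hz => (equivalence n).trans ((equivalence n).symm h) hz,
      fun hz => (equivalence n).trans h hz⟩

end BallEquiv

/-- The balls of a Sturmian coloring with their labels form a refinement. -/
theorem Labeling.exists_refinement {φ : V → α} {a b : α} {d : ℕ} (hd : 3 ≤ d)
    (hT : IsRegularTree G d) (hSt : IsSturmian G φ) (hab : a ≠ b) (L : Labeling G φ a b) :
    ∃ s c α' β' : ℕ → V, Refinement G (BallEquiv G φ) s c α' β' ∧
      (∀ n, L.S n = ballClass G φ n (s n)) ∧ (∀ n, L.C n = ballClass G φ n (c n)) ∧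
      (∀ n, L.A n = ballClass G φ n (α' n)) ∧ (∀ n, L.B n = ballClass G φ n (β' n)) := by
  have hG : G.Connected := hT.isTree.connected
  choose s hs _ using L.S_special
  choose c _ hcS hcC using L.C_central
  have hA : ∀ n, ∃ x, L.A n = ballClass G φ n x := by
    rintro (_ | n)
    · obtain ⟨x, -, h⟩ := L.A0_col
      exact ⟨x, h⟩
    · obtain ⟨x, -, -, h⟩ := L.A_ext n
      exact ⟨x, h⟩
  have hB : ∀ n, ∃ x, L.B n = ballClass G φ n x := by
    rintro (_ | n)
    · obtain ⟨x, -, h⟩ := L.B0_col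
      exact ⟨x, h⟩
    · obtain ⟨x, -, -, h⟩ := L.B_ext n
      exact ⟨x, h⟩
  choose α' hα using hA
  choose β' hβ using hB
  have symm : ∀ {n x y}, BallEquiv G φ n x y → BallEquiv G φ n y x :=
    fun h => (BallEquiv.equivalence _).symm h
  have trans : ∀ {n x y z}, BallEquiv G φ n x y → BallEquiv G φ n y z → BallEquiv G φ n x z :=
    fun h h' => (BallEquiv.equivalence _).trans h h'
  have left : ∀ n, BallEquiv G φ n (α' (n + 1)) (s n) := by
    intro n
    obtain ⟨x, -, h1, h2⟩ := L.A_ext n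
    rw [hs, BallEquiv.ballClass_eq_iff] at h1
    rw [hα, BallEquiv.ballClass_eq_iff] at h2
    exact trans (h2.of_succ hG) (symm h1)
  have right : ∀ n, BallEquiv G φ n (β' (n + 1)) (s n) := by
    intro n
    obtain ⟨x, -, h1, h2⟩ := L.B_ext n
    rw [hs, BallEquiv.ballClass_eq_iff] at h1
    rw [hβ, BallEquiv.ballClass_eq_iff] at h2
    exact trans (h2.of_succ hG) (symm h1)
  have hne : ∀ n, ¬ BallEquiv G φ (n + 1) (α' (n + 1)) (β' (n + 1)) := by
    intro n h
    refine L.AB_ne n ?_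
    rw [hα, hβ, BallEquiv.ballClass_eq_iff]
    exact h
  have count : ∀ n {x y u v : V}, BallEquiv G φ n x y → ¬ BallEquiv G φ (n + 1) x y →
      ¬ BallEquiv G φ (n + 1) u y → ¬ BallEquiv G φ (n + 1) v y → BallEquiv G φ n u v →
      BallEquiv G φ (n + 1) u v := fun n _ _ _ _ =>
    rel_of_ncard_classes (BallEquiv.equivalence n) (BallEquiv.equivalence (n + 1))
      (fun _ _ h => h.of_succ hG) (hSt n) (hSt (n + 1))
  refine ⟨s, c, α', β', ?_, hs, hcC, hα, hβ⟩
  refine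
    { conn := hG
      locallyFinite := fun v => Set.finite_of_ncard_pos (by rw [hT.regular]; omega)
      equiv := BallEquiv.equivalence
      mono := fun n x y h => h.of_succ hG
      step := fun n x y u h hu => h.exists_adj hG hu
      left_special := left
      right_special := right
      left_ne_right := hne
      refine_of_not_special := ?_
      split := ?_
      base := ?_
      left_adj := ?_
      right_adj := ?_
      central := ?_
      not_covered := ?_ }
  · intro n x y hx hxy
    by_contra hxy'
    have hy : ∀ {w}, BallEquiv G φ n w (s n) → ¬ BallEquiv G φ (n + 1) w y := fun hw h =>
      hx (trans hxy (trans (symm (h.of_succ hG)) hw))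
    exact hne n (count n hxy hxy' (hy (left n)) (hy (right n)) (trans (left n) (symm (right n))))
  · intro n x hx
    by_cases h : BallEquiv G φ (n + 1) x (β' (n + 1))
    · exact Or.inr h
    · exact Or.inl (count n (trans (left n) (symm (right n))) (hne n) h (hne n)
        (trans hx (symm (left n))))
  · intro x
    have h0 : L.A 0 ≠ L.B 0 := by
      obtain ⟨x, hxa, hx⟩ := L.A0_col
      obtain ⟨y, hyb, hy⟩ := L.B0_col
      rw [hx, hy, Ne, BallEquiv.ballClass_eq_iff]
      exact fun h => hab (hxa.symm.trans (h.color_eq.trans hyb))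
    have hsub : ({L.A 0, L.B 0} : Set (Set V)) ⊆ ballClasses G φ 0 := by
      rintro D (rfl | rfl)
      · exact ⟨_, hα 0⟩
      · exact ⟨_, hβ 0⟩
    have heq := Set.eq_of_subset_of_ncard_le hsub
      (by rw [hSt 0, Set.ncard_pair h0]) (Set.finite_of_ncard_pos (by rw [hSt 0]; omega))
    have hx : ballClass G φ 0 x ∈ ({L.A 0, L.B 0} : Set (Set V)) := heq ▸ ⟨x, rfl⟩
    rcases hx with hx | hx
    · exact Or.inl (BallEquiv.ballClass_eq_iff.1 (hx.trans (hα 0)))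
    · exact Or.inr (BallEquiv.ballClass_eq_iff.1 (hx.trans (hβ 0)))
  · intro n x hx
    obtain ⟨y, hxy, hy⟩ := L.A_adj n x (by rw [hα]; exact symm hx)
    rw [hα] at hy
    exact ⟨y, hxy, symm hy⟩
  · intro n x hx
    obtain ⟨y, hxy, hy⟩ := L.B_adj n x (by rw [hβ]; exact symm hx)
    rw [hβ] at hy
    exact ⟨y, hxy, symm hy⟩
  · intro n
    have h := hcS n
    rw [hs, BallEquiv.ballClass_eq_iff] at h
    exact (symm h).of_succ hG
  · rintro ⟨F, hF, h⟩
    have hsub : ballClasses G φ F.ncard ⊆ ballClass G φ F.ncard '' F := by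
      rintro D ⟨x, rfl⟩
      obtain ⟨f, hf, hxf⟩ := h x
      exact ⟨f, hf, BallEquiv.ballClass_eq_iff.2 (symm (hxf _))⟩
    have h1 := Set.ncard_le_ncard hsub (hF.image _)
    have h2 := Set.ncard_image_le (f := ballClass G φ F.ncard) hF
    rw [hSt] at h1
    omega

/-- Every vertex of a cycle is next to two other vertices of the cycle. -/
theorem IsCycleIn.exists_neighbors {φ : V → α} {n k : ℕ} {c : ℕ → Set V}
    (hc : IsCycleIn G φ n k c) {i : ℕ} (hi : i < k) :
    ∃ j < k, ∃ l < k, j ≠ i ∧ l ≠ i ∧ j ≠ l ∧ CanAdj G (c i) (c j) ∧ CanAdj G (c i) (c l) := by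
  obtain ⟨hk, -, hadj, -⟩ := hc
  have symm : ∀ {D E : Set V}, CanAdj G D E → CanAdj G E D :=
    fun ⟨x, hx, y, hy, h⟩ => ⟨y, hy, x, hx, h.symm⟩
  have step : ∀ j < k, ((j + 1) % k = j + 1 ∧ j + 1 < k) ∨ ((j + 1) % k = 0 ∧ j + 1 = k) := by
    intro j hj
    rcases Nat.lt_or_ge (j + 1) k with h | h
    · exact Or.inl ⟨Nat.mod_eq_of_lt h, h⟩
    · have : j + 1 = k := by omega
      exact Or.inr ⟨by rw [this, Nat.mod_self], this⟩
  obtain ⟨l, hl, hli⟩ : ∃ l < k, (l + 1) % k = i := by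
    rcases Nat.eq_zero_or_pos i with h | h
    · exact ⟨k - 1, by omega, by rw [Nat.sub_add_cancel (by omega), Nat.mod_self, h]⟩
    · exact ⟨i - 1, by omega, by rw [Nat.sub_add_cancel h, Nat.mod_eq_of_lt hi]⟩
  have h1 := step i hi
  have h2 := step l hl
  have h3 := hadj l hl
  rw [hli] at h2 h3
  exact ⟨(i + 1) % k, Nat.mod_lt _ (by omega), l, hl, by omega, by omega, by omega,
    hadj i hi, symm h3⟩

end

/-- Lemma 5.1: if `G_n` has a cycle, then the special ball `S_n` lies
on the cycle, and apart from itself `S_n` is adjacent in `G_n` only to `A_n, B_n, C_n`. -/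
theorem cycle_through_special {V α : Type} (G : SimpleGraph V) (d : ℕ) (hd : 3 ≤ d)
    (hT : IsRegularTree G d) (φ : V → α) (hSt : IsSturmian G φ)
    (a b : α) (hab : a ≠ b) (L : Labeling G φ a b)
    (n k : ℕ) (c : ℕ → Set V) (hc : IsCycleIn G φ n k c) :
    (∃ i < k, c i = L.S n) ∧
    (∀ D ∈ ballClasses G φ n, D ≠ L.S n → CanAdj G (L.S n) D →
      D = L.A n ∨ D = L.B n ∨ D = L.C n) := by
  obtain ⟨s, ct, α', β', H, hS, hC, hA, hB⟩ := L.exists_refinement hd hT hSt hab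
  have hrep : ∀ i < k, ∃ x, c i = ballClass G φ n x := hc.2.1
  have := H.conn.nonempty
  choose! r hr using hrep
  have mem : ∀ i < k, ∀ x, x ∈ c i → BallEquiv G φ n x (r i) := fun i hi x hx => by
    rw [hr i hi] at hx
    exact H.symm hx
  have ne : ∀ i < k, ∀ j < k, i ≠ j → ¬ BallEquiv G φ n (r i) (r j) := fun i hi j hj hij h =>
    hij (hc.2.2.2 i hi j hj (by rw [hr i hi, hr j hj, BallEquiv.ballClass_eq_iff.2 h]))
  have adj : ∀ i < k, ∀ j < k, CanAdj G (c i) (c j) → ∃ x y, G.Adj x y ∧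
      BallEquiv G φ n x (r i) ∧ BallEquiv G φ n y (r j) :=
    fun i hi j hj ⟨x, hx, y, hy, h⟩ => ⟨x, y, h, mem i hi x hx, mem j hj y hy⟩
  have sub : ∀ {x x' y y'}, ¬ BallEquiv G φ n x' y' → BallEquiv G φ n x x' →
      BallEquiv G φ n y y' → ¬ BallEquiv G φ n x y :=
    fun h hx hy h' => h (H.trans (H.symm hx) (H.trans h' hy))
  have hmeet : ∃ i < k, BallEquiv G φ n (r i) (s n) := by
    by_contra! hcon
    have h0 : 0 < k := by have := hc.1; omega
    obtain ⟨u, v, huv, ⟨i, hi, hu⟩, hv⟩ := exists_boundary_edge H.conn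
      (P := fun x => ∃ i < k, BallEquiv G φ n x (r i)) ⟨0, h0, H.refl n (r 0)⟩
      (fun ⟨i, hi, h⟩ => hcon i hi (H.symm h))
    obtain ⟨j, hj, l, hl, hji, hli, hjl, h1, h2⟩ := hc.exists_neighbors hi
    obtain ⟨x, y, hxy, hx, hy⟩ := adj i hi j hj h1
    obtain ⟨x', z, hxz, hx', hz⟩ := adj i hi l hl h2
    have hns : ∀ {w}, BallEquiv G φ n w (r i) → ¬ BallEquiv G φ n w (s n) := fun hw h =>
      hcon i hi (H.trans (H.symm hw) h)
    obtain ⟨y', hy', hyy'⟩ := H.adj_of_not_special (hns hx) (H.trans hx (H.symm hu)) hxy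
    obtain ⟨z', hz', hzz'⟩ := H.adj_of_not_special (hns hx') (H.trans hx' (H.symm hu)) hxz
    have ey := H.trans (H.symm hyy') hy
    have ez := H.trans (H.symm hzz') hz
    refine H.no_three_neighbors (n := n) huv hy' hz' ?_ ?_ ?_ ?_ ?_ ?_
    · exact fun h => hv ⟨i, hi, H.trans (H.symm h) hu⟩
    · exact sub (ne i hi j hj hji.symm) hu ey
    · exact sub (ne i hi l hl hli.symm) hu ez
    · exact fun h => hv ⟨j, hj, H.trans h ey⟩
    · exact fun h => hv ⟨l, hl, H.trans h ez⟩
    · exact sub (ne j hj l hl hjl) ey ez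
  obtain ⟨i, hi, his⟩ := hmeet
  refine ⟨⟨i, hi, by rw [hr i hi, hS, BallEquiv.ballClass_eq_iff.2 his]⟩, ?_⟩
  rintro D ⟨t, rfl⟩ hDS ⟨x, hx, y, hy, hxy⟩
  by_contra! hcon
  obtain ⟨hDA, hDB, hDC⟩ := hcon
  rw [hS, Ne, BallEquiv.ballClass_eq_iff] at hDS
  rw [hA, Ne, BallEquiv.ballClass_eq_iff] at hDA
  rw [hB, Ne, BallEquiv.ballClass_eq_iff] at hDB
  rw [hC, Ne, BallEquiv.ballClass_eq_iff] at hDC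
  rw [hS] at hx
  have dist : ∀ j < k, j ≠ i → CanAdj G (c i) (c j) →
      BallEquiv G φ n (r j) (α' n) ∨ BallEquiv G φ n (r j) (β' n) ∨
        BallEquiv G φ n (r j) (ct n) := by
    intro j hj hji hadj
    by_contra! hcon
    obtain ⟨h1, h2, h3⟩ := hcon
    obtain ⟨m, hm, hmj, hmi, hjm⟩ : ∃ m < k, m ≠ j ∧ m ≠ i ∧ CanAdj G (c j) (c m) := by
      obtain ⟨p, hp, q, hq, hpj, hqj, hpq, hjp, hjq⟩ := hc.exists_neighbors hj
      by_cases hpi : p = i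
      · exact ⟨q, hq, hqj, fun h => hpq (hpi.trans h.symm), hjq⟩
      · exact ⟨p, hp, hpj, hpi, hjp⟩
    have hjs : ¬ BallEquiv G φ n (r j) (s n) := fun h =>
      ne j hj i hi hji (H.trans h (H.symm his))
    have hms : ¬ BallEquiv G φ n (r m) (s n) := fun h =>
      ne m hm i hi hmi (H.trans h (H.symm his))
    obtain ⟨p, q, hpq, hp, hq⟩ := adj i hi j hj hadj
    obtain ⟨q', w, hqw, hq', hw⟩ := adj j hj m hm hjm
    obtain ⟨w', hw', hww'⟩ := H.adj_of_not_special (fun h => hjs (H.trans (H.symm hq') h))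
      (H.trans hq' (H.symm hq)) hqw
    have ew := H.trans (H.symm hww') hw
    rcases H.neighbor_of_undistinguished (H.trans hp his) hpq
      (fun h => hjs (H.trans (H.symm hq) h)) (fun h => h1 (H.trans (H.symm hq) h))
      (fun h => h2 (H.trans (H.symm hq) h)) (fun h => h3 (H.trans (H.symm hq) h)) hw' with h | h
    · exact sub (ne j hj m hm hmj.symm) hq ew h
    · exact hms (H.trans (H.symm ew) h)
  obtain ⟨j, hj, l, hl, hji, hli, hjl, h1, h2⟩ := hc.exists_neighbors hi
  refine ne j hj l hl hjl (H.distinguished_unique (H.symm hx) hxy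
    (fun h => hDS (H.trans hy h)) (fun h => hDA (H.trans hy h)) (fun h => hDB (H.trans hy h))
    (fun h => hDC (H.trans hy h)) (dist j hj hji h1) ?_ (dist l hl hli h2) ?_)
  · exact fun h => ne j hj i hi hji (H.trans h (H.symm his))
  · exact fun h => ne l hl i hi hli (H.trans h (H.symm his))

end Sturm
end
end

section
/- Let φ be a Sturmian coloring of a d-regular tree. (1) If G_n has a cycle not containing C_n, then G_{n+ℓ} has a cycle containing C_{n+ℓ} for some ℓ ≥ 1. (2) If G_n has a cycle containing C_n = S_n, then G_{n+1} has a cycle containing C_{n+1} ≠ S_{n+1}. -/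
open scoped Classical

noncomputable section

namespace Sturm

/-! ### Ball isomorphisms as maps of the whole vertex set -/

/-- The maps `f`, `g` restrict to mutually inverse isomorphisms between the `n`-balls
centered at `x` and `y`. -/
structure IsBallIso {V α : Type} (G : SimpleGraph V) (φ : V → α) (n : ℕ) (x y : V)
    (f g : V → V) : Prop where
  center : f x = y
  map : ∀ u, G.dist x u ≤ n → G.dist y (f u) ≤ n
  inv_map : ∀ u, G.dist y u ≤ n → G.dist x (g u) ≤ n
  left : ∀ u, G.dist x u ≤ n → g (f u) = u
  right : ∀ u, G.dist y u ≤ n → f (g u) = u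
  adj : ∀ u v, G.dist x u ≤ n → G.dist x v ≤ n → (G.Adj u v ↔ G.Adj (f u) (f v))
  color : ∀ u, G.dist x u ≤ n → φ (f u) = φ u

section Balls

variable {V α : Type} {G : SimpleGraph V} {φ : V → α} {n N : ℕ} {x y z : V} {f g : V → V}

theorem IsBallIso.symm (h : IsBallIso G φ n x y f g) : IsBallIso G φ n y x g f where
  center := by rw [← h.center]; exact h.left x (by simp)
  map := h.inv_map
  inv_map := h.map
  left := h.right
  right := h.left
  adj u v hu hv := by
    rw [h.adj _ _ (h.inv_map u hu) (h.inv_map v hv), h.right u hu, h.right v hv]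
  color u hu := by rw [← h.color _ (h.inv_map u hu), h.right u hu]

theorem ballEquiv_iff_exists_isBallIso :
    BallEquiv G φ n x y ↔ ∃ f g, IsBallIso G φ n x y f g := by
  constructor
  · rintro ⟨e, hadj, hcol, hcen⟩
    refine ⟨fun u => if h : G.dist x u ≤ n then (e ⟨u, h⟩).1 else u,
      fun u => if h : G.dist y u ≤ n then (e.symm ⟨u, h⟩).1 else u, ?_⟩
    constructor
    · simpa using hcen
    · intro u hu
      simpa [hu] using (e ⟨u, hu⟩).2
    · intro u hu
      simpa [hu] using (e.symm ⟨u, hu⟩).2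
    · intro u hu
      simp [hu, (e ⟨u, hu⟩).2]
    · intro u hu
      simp [hu, (e.symm ⟨u, hu⟩).2]
    · intro u v hu hv
      simpa [hu, hv] using hadj ⟨u, hu⟩ ⟨v, hv⟩
    · intro u hu
      simpa [hu] using hcol ⟨u, hu⟩
  · rintro ⟨f, g, h⟩
    exact ⟨⟨fun u => ⟨f u.1, h.map _ u.2⟩, fun u => ⟨g u.1, h.inv_map _ u.2⟩,
      fun u => Subtype.ext (h.left _ u.2), fun u => Subtype.ext (h.right _ u.2)⟩,
      fun u v => h.adj _ _ u.2 v.2, fun u => h.color _ u.2, h.center⟩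

theorem BallEquiv.refl (x : V) : BallEquiv G φ n x x :=
  ballEquiv_iff_exists_isBallIso.2 ⟨id, id, by constructor <;> simp⟩

theorem BallEquiv.symm (h : BallEquiv G φ n x y) : BallEquiv G φ n y x := by
  obtain ⟨f, g, h⟩ := ballEquiv_iff_exists_isBallIso.1 h
  exact ballEquiv_iff_exists_isBallIso.2 ⟨g, f, h.symm⟩

theorem BallEquiv.trans (h : BallEquiv G φ n x y) (h' : BallEquiv G φ n y z) :
    BallEquiv G φ n x z := by
  obtain ⟨f, g, h⟩ := ballEquiv_iff_exists_isBallIso.1 h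
  obtain ⟨f', g', h'⟩ := ballEquiv_iff_exists_isBallIso.1 h'
  refine ballEquiv_iff_exists_isBallIso.2 ⟨f' ∘ f, g ∘ g', ?_⟩
  have hs := h'.symm
  constructor
  · simp [h.center, h'.center]
  · exact fun u hu => h'.map _ (h.map _ hu)
  · exact fun u hu => h.inv_map _ (h'.inv_map _ hu)
  · intro u hu
    simp [h'.left _ (h.map _ hu), h.left _ hu]
  · intro u hu
    simp [h.right _ (h'.inv_map _ hu), h'.right _ hu]
  · intro u v hu hv
    exact (h.adj u v hu hv).trans (h'.adj _ _ (h.map _ hu) (h.map _ hv))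
  · intro u hu
    exact (h'.color _ (h.map _ hu)).trans (h.color _ hu)

theorem BallEquiv.color_eq_s17 (h : BallEquiv G φ n x y) : φ x = φ y := by
  obtain ⟨f, g, h⟩ := ballEquiv_iff_exists_isBallIso.1 h
  rw [← h.color x (by simp), h.center]

theorem exists_adj_dist_eq (hc : G.Connected) {k : ℕ} (h : G.dist x z = k + 1) :
    ∃ w, G.Adj w z ∧ G.dist x w = k := by
  obtain ⟨p, hp⟩ := hc.exists_walk_length_eq_dist z x
  rw [SimpleGraph.dist_comm, h] at hp
  cases p with
  | nil => simp at hp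
  | cons hadj q =>
    rename_i w
    refine ⟨w, hadj.symm, ?_⟩
    have h1 : G.dist w x ≤ q.length := SimpleGraph.dist_le q
    have h2 : q.length = k := by simpa using hp
    have h3 := hc.dist_triangle (u := x) (v := w) (w := z)
    have h4 : G.dist w z = 1 := SimpleGraph.dist_eq_one_iff_adj.2 hadj.symm
    rw [SimpleGraph.dist_comm] at h1
    omega

theorem IsBallIso.dist_le (hc : G.Connected) (h : IsBallIso G φ N x y f g)
    (hz : G.dist x z + n ≤ N) {u : V} (hu : G.dist z u ≤ n) :
    G.dist (f z) (f u) ≤ G.dist z u := by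
  induction hk : G.dist z u generalizing u with
  | zero =>
    rw [hc.dist_eq_zero_iff] at hk
    simp [hk]
  | succ k ih =>
    obtain ⟨w, hw, hd⟩ := exists_adj_dist_eq hc hk
    have h1 := ih (u := w) (by omega) hd
    have t1 := hc.dist_triangle (u := x) (v := z) (w := u)
    have t2 := hc.dist_triangle (u := x) (v := z) (w := w)
    have h2 := (h.adj w u (by omega) (by omega)).1 hw
    have h3 := hc.dist_triangle (u := f z) (v := f w) (w := f u)
    have h4 := SimpleGraph.dist_eq_one_iff_adj.2 h2
    omega

theorem IsBallIso.localize (hc : G.Connected) (h : IsBallIso G φ N x y f g)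
    (hz : G.dist x z + n ≤ N) : IsBallIso G φ n z (f z) f g := by
  have hfz : G.dist y (f z) + n ≤ N := by
    have := h.dist_le hc (n := N) (z := x) (by simp) (u := z) (by omega)
    rw [h.center] at this
    omega
  have key : ∀ u, G.dist z u ≤ n → G.dist x u ≤ N := fun u hu => by
    have := hc.dist_triangle (u := x) (v := z) (w := u)
    omega
  have key' : ∀ u, G.dist (f z) u ≤ n → G.dist y u ≤ N := fun u hu => by
    have := hc.dist_triangle (u := y) (v := f z) (w := u)
    omega
  constructor
  · rfl
  · exact fun u hu => (h.dist_le hc hz hu).trans hu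
  · intro u hu
    have := (h.symm.dist_le hc hfz hu)
    rw [h.left z (by omega)] at this
    exact this.trans hu
  · exact fun u hu => h.left u (key u hu)
  · exact fun u hu => h.right u (key' u hu)
  · exact fun u v hu hv => h.adj u v (key u hu) (key v hv)
  · exact fun u hu => h.color u (key u hu)

theorem BallEquiv.mono (hc : G.Connected) (h : BallEquiv G φ N x y) (hn : n ≤ N) :
    BallEquiv G φ n x y := by
  obtain ⟨f, g, h⟩ := ballEquiv_iff_exists_isBallIso.1 h
  have := h.localize hc (n := n) (z := x) (by simpa)
  rw [h.center] at this
  exact ballEquiv_iff_exists_isBallIso.2 ⟨f, g, this⟩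

theorem mem_ballClass : y ∈ ballClass G φ n x ↔ BallEquiv G φ n x y := Iff.rfl

theorem BallEquiv.nbrCount_eq (hc : G.Connected) (hfin : ∀ v, (G.neighborSet v).Finite)
    (h : BallEquiv G φ (n + 1) x y) (w : V) :
    nbrCount G x (ballClass G φ n w) = nbrCount G y (ballClass G φ n w) := by
  have key : ∀ x y, BallEquiv G φ (n + 1) x y →
      nbrCount G x (ballClass G φ n w) ≤ nbrCount G y (ballClass G φ n w) := by
    intro x y h
    obtain ⟨f, g, h⟩ := ballEquiv_iff_exists_isBallIso.1 h
    have hd : ∀ u, G.Adj x u → G.dist x u = 1 := fun u => SimpleGraph.dist_eq_one_iff_adj.2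
    refine Set.ncard_le_ncard_of_injOn f ?_ ?_ ((hfin y).subset Set.inter_subset_left)
    · rintro u ⟨hu, hw⟩
      have hu : G.Adj x u := hu
      have h1 := (h.adj x u (by simp) (by rw [hd u hu]; omega)).1 hu
      rw [h.center] at h1
      refine ⟨h1, BallEquiv.trans hw (ballEquiv_iff_exists_isBallIso.2
        ⟨f, g, h.localize hc (by rw [hd u hu]; omega)⟩)⟩
    · rintro u ⟨hu, -⟩ v ⟨hv, -⟩ huv
      have hu : G.Adj x u := hu
      have hv : G.Adj x v := hv
      rw [← h.left u (by rw [hd u hu]; omega), ← h.left v (by rw [hd v hv]; omega), huv]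
  exact le_antisymm (key x y h) (key y x h.symm)

/-- The relation obtained from `BallEquiv G φ (n - 1)` by comparing neighborhoods. -/
def NbrEquiv (G : SimpleGraph V) (φ : V → α) : ℕ → V → V → Prop
  | 0, x, y => BallEquiv G φ 0 x y
  | n + 1, x, y => BallEquiv G φ n x y ∧
      ∀ w, nbrCount G x (ballClass G φ n w) = nbrCount G y (ballClass G φ n w)

theorem BallEquiv.nbrEquiv (hc : G.Connected) (hfin : ∀ v, (G.neighborSet v).Finite)
    (h : BallEquiv G φ n x y) : NbrEquiv G φ n x y := by
  cases n with
  | zero => exact h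
  | succ n => exact ⟨h.mono hc (by omega), h.nbrCount_eq hc hfin⟩

theorem NbrEquiv.color_eq_s17 (h : NbrEquiv G φ n x y) : φ x = φ y := by
  cases n with
  | zero => exact BallEquiv.color_eq_s17 h
  | succ n => exact h.1.color_eq_s17

theorem exists_bijOn_of_ncard_eq {s t : Set V} (hs : s.Finite) (ht : t.Finite)
    {r : V → V → Prop} (hr : Equivalence r)
    (h : ∀ w, (s ∩ {z | r w z}).ncard = (t ∩ {z | r w z}).ncard) :
    ∃ σ : V → V, Set.BijOn σ s t ∧ ∀ u ∈ s, r u (σ u) := by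
  induction s, hs using Set.Finite.induction_on generalizing t with
  | empty =>
    have : t = ∅ := by
      by_contra hne
      obtain ⟨w, hw⟩ := Set.nonempty_iff_ne_empty.2 hne
      have := h w
      rw [Set.empty_inter, Set.ncard_empty, eq_comm,
        Set.ncard_eq_zero (ht.subset Set.inter_subset_left)] at this
      exact (Set.ext_iff.1 this w).1 ⟨hw, hr.refl w⟩
    exact ⟨id, by simp [this], by simp⟩
  | @insert a s ha hs ih =>
    obtain ⟨b, hbt, hb⟩ : (t ∩ {z | r a z}).Nonempty := by
      rw [← Set.ncard_pos (ht.subset Set.inter_subset_left), ← h a, Set.ncard_pos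
        ((hs.insert a).subset Set.inter_subset_left)]
      exact ⟨a, by simp, hr.refl a⟩
    obtain ⟨σ, hσ, hσr⟩ := ih (t := t \ {b}) (ht.subset Set.sdiff_subset) (by
      intro w
      have hw := h w
      have hab : r w a ↔ r w b :=
        ⟨fun h => hr.trans h hb, fun h => hr.trans h (hr.symm hb)⟩
      by_cases hwa : r w a
      · have e1 : insert a s ∩ {z | r w z} = insert a (s ∩ {z | r w z}) := by
          ext z
          simp only [Set.mem_inter_iff, Set.mem_insert_iff, Set.mem_ofPred_eq]
          constructor
          · tauto
          · rintro (rfl | h)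
            · exact ⟨Or.inl rfl, hwa⟩
            · tauto
        have e2 : (t \ {b}) ∩ {z | r w z} = (t ∩ {z | r w z}) \ {b} := by
          ext z
          simp only [Set.mem_inter_iff, Set.mem_sdiff, Set.mem_ofPred_eq]
          tauto
        rw [e1, Set.ncard_insert_of_notMem (fun h => ha h.1)
          (hs.subset Set.inter_subset_left)] at hw
        have hbm : b ∈ t ∩ {z | r w z} := ⟨hbt, hab.1 hwa⟩
        rw [e2, Set.ncard_sdiff_singleton_of_mem hbm]
        omega
      · have e1 : insert a s ∩ {z | r w z} = s ∩ {z | r w z} := by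
          ext z
          simp only [Set.mem_inter_iff, Set.mem_insert_iff, Set.mem_ofPred_eq]
          constructor
          · rintro ⟨rfl | h, h'⟩
            · exact absurd h' hwa
            · exact ⟨h, h'⟩
          · tauto
        have e2 : (t \ {b}) ∩ {z | r w z} = t ∩ {z | r w z} := by
          ext z
          simp only [Set.mem_inter_iff, Set.mem_sdiff, Set.mem_ofPred_eq,
            Set.mem_singleton_iff]
          constructor
          · tauto
          · rintro ⟨h1, h2⟩
            refine ⟨⟨h1, ?_⟩, h2⟩
            rintro rfl
            exact hwa (hab.2 h2)
        rw [e2, ← hw, e1])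
    refine ⟨Function.update σ a b, ?_, ?_⟩
    · have hne : ∀ u ∈ s, Function.update σ a b u = σ u := fun u hu =>
        Function.update_of_ne (by rintro rfl; exact ha hu) _ _
      have h1 : Set.BijOn (Function.update σ a b) s (t \ {b}) :=
        hσ.congr (fun u hu => (hne u hu).symm)
      have h2 := h1.insert (a := a) (by simp)
      simpa [Set.insert_eq_of_mem hbt] using h2
    · rintro u (rfl | hu)
      · simpa using hb
      · rw [Function.update_of_ne (by rintro rfl; exact ha hu)]
        exact hσr u hu

theorem eq_of_adj_of_dist (hT : G.IsTree) {q q' u : V} {i : ℕ} (h : G.Adj q u)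
    (h' : G.Adj q' u) (hq : G.dist x q = i) (hq' : G.dist x q' = i)
    (hu : G.dist x u = i + 1) : q = q' := by
  have key : ∀ q, G.Adj q u → G.dist x q = i →
      ∃ p : G.Walk x u, p.IsPath ∧ p.penultimate = q := by
    intro q h hq
    obtain ⟨p, hp⟩ := hT.connected.exists_walk_length_eq_dist x q
    refine ⟨p.concat h, ?_, by simp⟩
    exact (p.concat h).isPath_of_length_eq_dist (by simp [hp, hq, hu])
  obtain ⟨p, hp, e⟩ := key q h hq
  obtain ⟨p', hp', e'⟩ := key q' h' hq'
  rw [← e, ← e']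
  have := (hT.isAcyclic.subsingleton_path x u).elim ⟨p, hp⟩ ⟨p', hp'⟩
  rw [Subtype.mk.injEq] at this
  rw [this]

end Balls

/-! ### Extending ball equivalences in a tree -/

section Extension

variable {V α : Type} {G : SimpleGraph V} {φ : V → α} {n : ℕ} {x y : V}

/-- `f` maps the `i`-ball at `x` onto the `i`-ball at `y`, preserving distances to the
centers, adjacency, and the classes of smaller balls. -/
structure IsPartialIso (G : SimpleGraph V) (φ : V → α) (n : ℕ) (x y : V) (i : ℕ)
    (f : V → V) : Prop where
  center : f x = y
  dist_eq : ∀ u, G.dist x u ≤ i → G.dist y (f u) = G.dist x u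
  rel : ∀ u, G.dist x u ≤ i → NbrEquiv G φ (n - G.dist x u) u (f u)
  inj : ∀ u v, G.dist x u ≤ i → G.dist x v ≤ i → f u = f v → u = v
  surj : ∀ w, G.dist y w ≤ i → ∃ u, G.dist x u ≤ i ∧ f u = w
  adj : ∀ u v, G.dist x u ≤ i → G.dist x v ≤ i → G.Adj u v → G.Adj (f u) (f v)

theorem ballEquiv_equivalence (n : ℕ) : Equivalence (BallEquiv G φ n) :=
  ⟨BallEquiv.refl, BallEquiv.symm, BallEquiv.trans⟩

theorem IsPartialIso.exists_children_bijOn (hT : G.IsTree)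
    (hfin : ∀ v, (G.neighborSet v).Finite) {i : ℕ} (hi : i < n) {f : V → V}
    (h : IsPartialIso G φ n x y i f) {q : V} (hq : G.dist x q = i) :
    ∃ σ : V → V, Set.BijOn σ {z | G.Adj q z ∧ G.dist x z = i + 1}
      {z | G.Adj (f q) z ∧ G.dist y z = i + 1} ∧
      ∀ u, G.Adj q u → G.dist x u = i + 1 → BallEquiv G φ (n - (i + 1)) u (σ u) := by
  have hc := hT.connected
  have hrel := h.rel q hq.le
  obtain ⟨k, hk⟩ : ∃ k, n = i + 1 + k := ⟨n - (i + 1), by omega⟩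
  have hk1 : n - G.dist x q = k + 1 := by omega
  have hk2 : n - (i + 1) = k := by omega
  rw [hk1] at hrel
  rw [hk2]
  have hcount : ∀ w, ({z | G.Adj q z ∧ G.dist x z = i + 1} ∩
      {z | BallEquiv G φ k w z}).ncard = ({z | G.Adj (f q) z ∧ G.dist y z = i + 1} ∩
      {z | BallEquiv G φ k w z}).ncard := by
    intro w
    have hw : (G.neighborSet q ∩ {z | BallEquiv G φ k w z}).ncard =
      (G.neighborSet (f q) ∩ {z | BallEquiv G φ k w z}).ncard := hrel.2 w
    have hfq : G.dist y (f q) = i := by rw [h.dist_eq q hq.le, hq]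
    rcases Nat.eq_zero_or_pos i with rfl | hi0
    · rw [hc.dist_eq_zero_iff] at hq hfq
      subst hq
      have e : ∀ v, {z | G.Adj v z ∧ G.dist v z = 0 + 1} = G.neighborSet v := by
        intro v
        ext z
        simp
      rw [e, hfq, e, hw]
    · obtain ⟨j, rfl⟩ : ∃ j, i = j + 1 := ⟨i - 1, by omega⟩
      obtain ⟨p, hp, hpd⟩ := exists_adj_dist_eq hc hq
      have hfp : G.dist y (f p) = j := by rw [h.dist_eq p (by omega), hpd]
      have hfpq : G.Adj (f p) (f q) := h.adj p q (by omega) (by omega) hp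
      have hpp : BallEquiv G φ k p (f p) := by
        have := h.rel p (by omega)
        rw [show n - G.dist x p = k + 1 + 1 by omega] at this
        exact this.1.mono hc (by omega)
      have e : ∀ (x q p : V), G.Adj p q → G.dist x p = j → G.dist x q = j + 1 →
          {z | G.Adj q z ∧ G.dist x z = j + 1 + 1} = G.neighborSet q \ {p} := by
        intro x q p hpq hp hq
        ext z
        simp only [Set.mem_ofPred_eq, Set.mem_sdiff, SimpleGraph.mem_neighborSet,
          Set.mem_singleton_iff]
        constructor
        · rintro ⟨h1, h2⟩
          refine ⟨h1, ?_⟩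
          rintro rfl
          omega
        · rintro ⟨h1, h2⟩
          refine ⟨h1, ?_⟩
          rcases hT.dist_eq_dist_add_one_of_adj x h1 with h3 | h3
          · exact absurd (eq_of_adj_of_dist hT h1.symm hpq (by omega) hp hq) h2
          · omega
      rw [e x q p hp hpd hq, e y (f q) (f p) hfpq hfp hfq, Set.sdiff_inter_right_comm,
        Set.sdiff_inter_right_comm]
      by_cases hwp : BallEquiv G φ k w p
      · have h1 : p ∈ G.neighborSet q ∩ {z | BallEquiv G φ k w z} := ⟨hp.symm, hwp⟩
        have h2 : f p ∈ G.neighborSet (f q) ∩ {z | BallEquiv G φ k w z} :=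
          ⟨hfpq.symm, hwp.trans hpp⟩
        rw [Set.ncard_sdiff_singleton_of_mem h1, Set.ncard_sdiff_singleton_of_mem h2, hw]
      · rw [Set.sdiff_singleton_eq_self (fun h => hwp h.2), Set.sdiff_singleton_eq_self
          (fun h => hwp (BallEquiv.trans h.2 hpp.symm)), hw]
  obtain ⟨σ, hσ, hr⟩ := exists_bijOn_of_ncard_eq ((hfin q).subset fun z hz => hz.1)
    ((hfin (f q)).subset fun z hz => hz.1) (ballEquiv_equivalence k) hcount
  exact ⟨σ, hσ, fun u h1 h2 => hr u ⟨h1, h2⟩⟩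

theorem IsPartialIso.exists_succ (hT : G.IsTree)
    (hfin : ∀ v, (G.neighborSet v).Finite) {i : ℕ} (hi : i < n) {f : V → V}
    (h : IsPartialIso G φ n x y i f) : ∃ f', IsPartialIso G φ n x y (i + 1) f' := by
  have hc := hT.connected
  have hch : ∀ q, ∃ σ : V → V, G.dist x q = i →
      Set.BijOn σ {z | G.Adj q z ∧ G.dist x z = i + 1}
      {z | G.Adj (f q) z ∧ G.dist y z = i + 1} ∧
      ∀ u, G.Adj q u → G.dist x u = i + 1 → BallEquiv G φ (n - (i + 1)) u (σ u) := by
    intro q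
    by_cases hq : G.dist x q = i
    · obtain ⟨σ, h1⟩ := h.exists_children_bijOn hT hfin hi hq
      exact ⟨σ, fun _ => h1⟩
    · exact ⟨id, fun h => absurd h hq⟩
  choose σ hσ using hch
  have hpar : ∀ u, ∃ q, G.dist x u = i + 1 → G.Adj q u ∧ G.dist x q = i := by
    intro u
    by_cases hu : G.dist x u = i + 1
    · obtain ⟨q, hq⟩ := exists_adj_dist_eq hc hu
      exact ⟨q, fun _ => hq⟩
    · exact ⟨u, fun h => absurd h hu⟩
  choose par hpar using hpar
  have par_eq : ∀ q u, G.Adj q u → G.dist x q = i → G.dist x u = i + 1 → par u = q :=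
    fun q u h1 h2 h3 => eq_of_adj_of_dist hT (hpar u h3).1 h1 (hpar u h3).2 h2 h3
  have himg : ∀ u, G.dist x u = i + 1 →
      G.Adj (f (par u)) (σ (par u) u) ∧ G.dist y (σ (par u) u) = i + 1 :=
    fun u hu => (hσ _ (hpar u hu).2).1.mapsTo ⟨(hpar u hu).1, hu⟩
  let f' : V → V := fun u => if G.dist x u ≤ i then f u else σ (par u) u
  have f'_old : ∀ u, G.dist x u ≤ i → f' u = f u := fun u hu => by simp [f', hu]
  have f'_new : ∀ u, G.dist x u = i + 1 → f' u = σ (par u) u := fun u hu => by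
    simp [f', hu]
  have cases_le : ∀ u : V, G.dist x u ≤ i + 1 → G.dist x u ≤ i ∨ G.dist x u = i + 1 :=
    fun u hu => by omega
  have dist_f' : ∀ u, G.dist x u ≤ i + 1 → G.dist y (f' u) = G.dist x u := by
    intro u hu
    rcases cases_le u hu with h1 | h1
    · rw [f'_old u h1, h.dist_eq u h1]
    · rw [f'_new u h1, (himg u h1).2, h1]
  have adj_f' : ∀ u v, G.dist x u ≤ i → G.dist x v = i + 1 → G.Adj u v →
      G.Adj (f' u) (f' v) := by
    intro u v hu hv huv
    have hu' : G.dist x u = i := by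
      have := hT.dist_eq_dist_add_one_of_adj x huv
      omega
    rw [f'_old u hu, f'_new v hv]
    have := (himg v hv).1
    rwa [par_eq u v huv hu' hv] at this ⊢
  refine ⟨f', ?_, dist_f', ?_, ?_, ?_, ?_⟩
  · rw [f'_old x (by simp), h.center]
  · intro u hu
    rcases cases_le u hu with h1 | h1
    · rw [f'_old u h1]
      exact h.rel u h1
    · rw [f'_new u h1, h1]
      exact ((hσ _ (hpar u h1).2).2 u (hpar u h1).1 h1).nbrEquiv hc hfin
  · intro u v hu hv huv
    have hd : G.dist x u = G.dist x v := by rw [← dist_f' u hu, ← dist_f' v hv, huv]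
    rcases cases_le u hu with h1 | h1
    · have h2 : G.dist x v ≤ i := by omega
      rw [f'_old u h1, f'_old v h2] at huv
      exact h.inj u v h1 h2 huv
    · have h2 : G.dist x v = i + 1 := by omega
      rw [f'_new u h1, f'_new v h2] at huv
      have hu1 := himg u h1
      have hv1 := himg v h2
      rw [← huv] at hv1
      have hpd : ∀ w, G.dist x w = i + 1 → G.dist y (f (par w)) = i := fun w hw => by
        rw [h.dist_eq _ (hpar w hw).2.le, (hpar w hw).2]
      have e := eq_of_adj_of_dist hT hu1.1 hv1.1 (hpd u h1) (hpd v h2) hu1.2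
      have e' := h.inj _ _ (hpar u h1).2.le (hpar v h2).2.le e
      rw [← e'] at huv
      refine (hσ _ (hpar u h1).2).1.injOn ⟨(hpar u h1).1, h1⟩ ⟨?_, h2⟩ huv
      rw [e']
      exact (hpar v h2).1
  · intro w hw
    rcases (show G.dist y w ≤ i ∨ G.dist y w = i + 1 by omega) with h1 | h1
    · obtain ⟨u, hu, rfl⟩ := h.surj w h1
      exact ⟨u, by omega, f'_old u hu⟩
    · obtain ⟨p, hp, hpd⟩ := exists_adj_dist_eq hc h1
      obtain ⟨q, hq, rfl⟩ := h.surj p hpd.le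
      have hq' : G.dist x q = i := by rw [← h.dist_eq q hq, hpd]
      obtain ⟨u, ⟨hu1, hu2⟩, rfl⟩ := (hσ q hq').1.surjOn ⟨hp, h1⟩
      exact ⟨u, hu2.le, by rw [f'_new u hu2, par_eq q u hu1 hq' hu2]⟩
  · intro u v hu hv huv
    rcases cases_le u hu with h1 | h1 <;> rcases cases_le v hv with h2 | h2
    · rw [f'_old u h1, f'_old v h2]
      exact h.adj u v h1 h2 huv
    · exact adj_f' u v h1 h2 huv
    · exact (adj_f' v u h2 h1 huv.symm).symm
    · have := hT.dist_eq_dist_add_one_of_adj x huv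
      omega

theorem NbrEquiv.ballEquiv (hT : G.IsTree) (hfin : ∀ v, (G.neighborSet v).Finite)
    (h : NbrEquiv G φ n x y) : BallEquiv G φ n x y := by
  have hc := hT.connected
  have key : ∀ i ≤ n, ∃ f, IsPartialIso G φ n x y i f := by
    intro i
    induction i with
    | zero =>
      intro _
      refine ⟨fun _ => y, rfl, ?_, ?_, ?_, ?_, ?_⟩ <;>
        simp only [Nat.le_zero, hc.dist_eq_zero_iff]
      · rintro u rfl
        simp
      · rintro u rfl
        simpa using h
      · rintro u v rfl rfl _
        rfl
      · rintro w rfl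
        exact ⟨x, rfl, rfl⟩
      · rintro u v rfl rfl h
        exact absurd h (SimpleGraph.irrefl _)
    | succ i ih =>
      intro hi
      obtain ⟨f, hf⟩ := ih (by omega)
      exact hf.exists_succ hT hfin hi
  obtain ⟨f, hf⟩ := key n le_rfl
  choose! g hg using hf.surj
  refine ballEquiv_iff_exists_isBallIso.2 ⟨f, g, hf.center, ?_, ?_, ?_, ?_, ?_, ?_⟩
  · exact fun u hu => (hf.dist_eq u hu).le.trans hu
  · exact fun u hu => (hg u hu).1
  · intro u hu
    have := hg (f u) ((hf.dist_eq u hu).le.trans hu)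
    exact hf.inj _ _ this.1 hu this.2
  · exact fun u hu => (hg u hu).2
  · intro u v hu hv
    refine ⟨hf.adj u v hu hv, fun hadj => ?_⟩
    have key : ∀ u v, G.dist x u ≤ n → G.dist x v ≤ n → G.Adj (f u) (f v) →
        G.dist y (f v) = G.dist y (f u) + 1 → G.Adj u v := by
      intro u v hu hv hadj hd
      rw [hf.dist_eq u hu, hf.dist_eq v hv] at hd
      obtain ⟨q, hq, hqd⟩ := exists_adj_dist_eq hc hd
      have h1 := hf.adj q v (by omega) hv hq
      have := eq_of_adj_of_dist hT h1 hadj (by rw [hf.dist_eq q (by omega), hqd])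
        (hf.dist_eq u hu) (by rw [hf.dist_eq v hv, hd])
      rwa [← hf.inj q u (by omega) hu this]
    rcases hT.dist_eq_dist_add_one_of_adj y hadj with h1 | h1
    · exact (key v u hv hu hadj.symm h1).symm
    · exact key u v hu hv hadj h1
  · exact fun u hu => (hf.rel u hu).color_eq_s17.symm

end Extension

/-! ### Classes of balls and adjacency -/

section Classes

variable {V α : Type} {G : SimpleGraph V} {φ : V → α} {n : ℕ} {x y : V} {D D' : Set V}

theorem ballClass_mem_ballClasses (n : ℕ) (x : V) : ballClass G φ n x ∈ ballClasses G φ n :=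
  ⟨x, rfl⟩

theorem self_mem_ballClass (n : ℕ) (x : V) : x ∈ ballClass G φ n x := BallEquiv.refl x

theorem nonempty_of_mem_ballClasses (hD : D ∈ ballClasses G φ n) : D.Nonempty := by
  obtain ⟨x, rfl⟩ := hD
  exact ⟨x, self_mem_ballClass n x⟩

theorem mem_iff_ballEquiv (hD : D ∈ ballClasses G φ n) (hx : x ∈ D) :
    y ∈ D ↔ BallEquiv G φ n x y := by
  obtain ⟨z, rfl⟩ := hD
  exact ⟨fun h => (BallEquiv.symm hx).trans h, fun h => BallEquiv.trans hx h⟩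

theorem eq_ballClass (hD : D ∈ ballClasses G φ n) (hx : x ∈ D) : D = ballClass G φ n x :=
  Set.ext fun _ => mem_iff_ballEquiv hD hx

theorem eq_of_mem_of_mem (hD : D ∈ ballClasses G φ n) (hD' : D' ∈ ballClasses G φ n)
    (hx : x ∈ D) (hx' : x ∈ D') : D = D' := by
  rw [eq_ballClass hD hx, eq_ballClass hD' hx']

theorem ballClass_eq_of_ballEquiv (h : BallEquiv G φ n x y) :
    ballClass G φ n x = ballClass G φ n y :=
  eq_ballClass (ballClass_mem_ballClasses n x) h

theorem CanAdj.symm (h : CanAdj G D D') : CanAdj G D' D := by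
  obtain ⟨x, hx, y, hy, hadj⟩ := h
  exact ⟨y, hy, x, hx, hadj.symm⟩

theorem CanAdj.mono {F F' : Set V} (h : CanAdj G D D') (hF : D ⊆ F) (hF' : D' ⊆ F') :
    CanAdj G F F' := by
  obtain ⟨x, hx, y, hy, hadj⟩ := h
  exact ⟨x, hF hx, y, hF' hy, hadj⟩

theorem nbrCount_pos_iff (hfin : ∀ v, (G.neighborSet v).Finite) :
    0 < nbrCount G x D ↔ ∃ y, G.Adj x y ∧ y ∈ D := by
  rw [nbrCount, Set.ncard_pos ((hfin x).subset Set.inter_subset_left)]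
  rfl

end Classes

/-! ### The labels of a Sturmian coloring -/

/-- The part of the data of a labeled Sturmian coloring of a regular tree which is
symmetric in the letters `A` and `B`. -/
structure SpecialFrame {V α : Type} (G : SimpleGraph V) (φ : V → α) (S A B : ℕ → Set V) :
    Prop where
  tree : G.IsTree
  fin : ∀ v, (G.neighborSet v).Finite
  regular : ∀ v w, (G.neighborSet v).ncard = (G.neighborSet w).ncard
  sturm : IsSturmian G φ
  S_mem : ∀ n, S n ∈ ballClasses G φ n
  A_mem : ∀ n, A n ∈ ballClasses G φ n
  B_mem : ∀ n, B n ∈ ballClasses G φ n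
  AB_ne : ∀ n, A n ≠ B n
  A_sub : ∀ n, A (n + 1) ⊆ S n
  B_sub : ∀ n, B (n + 1) ⊆ S n
  A_adj : ∀ n, AlwaysAdjTo G (A (n + 1)) (A n)
  B_adj : ∀ n, AlwaysAdjTo G (B (n + 1)) (B n)

namespace SpecialFrame

variable {V α : Type} {G : SimpleGraph V} {φ : V → α} {S A B : ℕ → Set V}
  {m n : ℕ} {x y : V} {D D' : Set V}

theorem swap (h : SpecialFrame G φ S A B) : SpecialFrame G φ S B A where
  tree := h.tree
  fin := h.fin
  regular := h.regular
  sturm := h.sturm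
  S_mem := h.S_mem
  A_mem := h.B_mem
  B_mem := h.A_mem
  AB_ne n := (h.AB_ne n).symm
  A_sub := h.B_sub
  B_sub := h.A_sub
  A_adj := h.B_adj
  B_adj := h.A_adj

theorem mono (h : SpecialFrame G φ S A B) (hmn : m ≤ n) (hxy : BallEquiv G φ n x y) :
    BallEquiv G φ m x y :=
  hxy.mono h.tree.connected hmn

theorem finite_ballClasses (h : SpecialFrame G φ S A B) (n : ℕ) :
    (ballClasses G φ n).Finite :=
  Set.finite_of_ncard_ne_zero (by rw [h.sturm n]; omega)

theorem disjoint (h : SpecialFrame G φ S A B) (hx : x ∈ A n) : x ∉ B n :=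
  fun hx' => h.AB_ne n (eq_of_mem_of_mem (h.A_mem n) (h.B_mem n) hx hx')

theorem ballEquiv_succ_of_notMem (h : SpecialFrame G φ S A B) (hxy : BallEquiv G φ n x y)
    (hx : x ∉ B (n + 1)) (hy : y ∉ B (n + 1)) : BallEquiv G φ (n + 1) x y := by
  let g : Set V → Set V := fun D => {z | ∃ w ∈ D, BallEquiv G φ n w z}
  have hg : ∀ w, g (ballClass G φ (n + 1) w) = ballClass G φ n w := by
    intro w
    ext z
    constructor
    · rintro ⟨v, hv, hvz⟩
      exact (h.mono (by omega) hv).trans hvz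
    · intro hz
      exact ⟨w, self_mem_ballClass _ w, hz⟩
  have hmaps : Set.MapsTo g (ballClasses G φ (n + 1) \ {B (n + 1)}) (ballClasses G φ n) := by
    rintro D ⟨⟨w, rfl⟩, -⟩
    rw [hg]
    exact ballClass_mem_ballClasses n w
  have hmem : ∀ w, w ∉ B (n + 1) →
      ballClass G φ (n + 1) w ∈ ballClasses G φ (n + 1) \ {B (n + 1)} := by
    intro w hw
    refine ⟨ballClass_mem_ballClasses _ w, ?_⟩
    rintro (e : _ = _)
    exact hw (e ▸ self_mem_ballClass _ w)
  have hsurj : Set.SurjOn g (ballClasses G φ (n + 1) \ {B (n + 1)}) (ballClasses G φ n) := by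
    rintro D ⟨w, rfl⟩
    by_cases hw : w ∈ B (n + 1)
    · obtain ⟨a, ha⟩ := nonempty_of_mem_ballClasses (h.A_mem (n + 1))
      refine ⟨_, hmem a (h.disjoint ha), ?_⟩
      rw [hg]
      exact ballClass_eq_of_ballEquiv
        ((mem_iff_ballEquiv (h.S_mem n) (h.A_sub n ha)).1 (h.B_sub n hw))
    · exact ⟨_, hmem w hw, hg w⟩
  have hcard : (ballClasses G φ (n + 1) \ {B (n + 1)}).ncard ≤ (ballClasses G φ n).ncard := by
    rw [Set.ncard_sdiff_singleton_of_mem (h.B_mem (n + 1)), h.sturm, h.sturm]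
    omega
  have hinj := Set.inj_on_of_surj_on_of_ncard_le (s := ballClasses G φ (n + 1) \ {B (n + 1)})
    (fun D _ => g D) hmaps (fun D hD => by
      obtain ⟨E, hE, e⟩ := hsurj hD
      exact ⟨E, hE, e⟩) hcard (hmem x hx) (hmem y hy)
    (by simp only [hg]; exact ballClass_eq_of_ballEquiv hxy)
    ((h.finite_ballClasses _).subset Set.sdiff_subset)
  rw [← mem_ballClass, hinj]
  exact self_mem_ballClass _ y

theorem mem_or_mem (h : SpecialFrame G φ S A B) (hx : x ∈ S n) :
    x ∈ A (n + 1) ∨ x ∈ B (n + 1) := by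
  by_contra! hcon
  obtain ⟨a, ha⟩ := nonempty_of_mem_ballClasses (h.A_mem (n + 1))
  have h1 : BallEquiv G φ n a x := (mem_iff_ballEquiv (h.S_mem n) (h.A_sub n ha)).1 hx
  exact hcon.1 ((mem_iff_ballEquiv (h.A_mem _) ha).2
    (h.ballEquiv_succ_of_notMem h1 (h.disjoint ha) hcon.2))

theorem ballEquiv_succ (h : SpecialFrame G φ S A B) (hx : x ∉ S n)
    (hxy : BallEquiv G φ n x y) : BallEquiv G φ (n + 1) x y := by
  refine h.ballEquiv_succ_of_notMem hxy (fun hb => hx (h.B_sub n hb)) fun hb => hx ?_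
  exact (mem_iff_ballEquiv (h.S_mem n) (h.B_sub n hb)).2 hxy.symm

theorem mem_ballClasses_succ (h : SpecialFrame G φ S A B) (hD : D ∈ ballClasses G φ n)
    (hne : D ≠ S n) : D ∈ ballClasses G φ (n + 1) := by
  obtain ⟨x, rfl⟩ := hD
  refine ⟨x, Set.ext fun y => ⟨fun hy => h.ballEquiv_succ (fun hx => hne ?_) hy,
    fun hy => h.mono (by omega) hy⟩⟩
  exact (eq_ballClass (h.S_mem n) hx).symm

theorem mem_zero_or_mem_zero (h : SpecialFrame G φ S A B) (x : V) : x ∈ A 0 ∨ x ∈ B 0 := by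
  have : ({A 0, B 0} : Set (Set V)) = ballClasses G φ 0 := by
    refine Set.eq_of_subset_of_ncard_le ?_ ?_ (h.finite_ballClasses 0)
    · rintro D (rfl | rfl)
      exacts [h.A_mem 0, h.B_mem 0]
    · rw [h.sturm, Set.ncard_pair (h.AB_ne 0)]
  have hx := ballClass_mem_ballClasses (G := G) (φ := φ) 0 x
  rw [← this] at hx
  rcases hx with e | e
  · exact Or.inl (e ▸ self_mem_ballClass 0 x)
  · exact Or.inr (e ▸ self_mem_ballClass 0 x)

theorem exists_eq_succ_of_ne (h : SpecialFrame G φ S A B) (hD : D ∈ ballClasses G φ n)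
    (hA : D ≠ A n) (hB : D ≠ B n) : ∃ m, n = m + 1 ∧ D ∈ ballClasses G φ m ∧ D ≠ S m := by
  obtain ⟨x, hx⟩ := nonempty_of_mem_ballClasses hD
  have hxA : x ∉ A n := fun h1 => hA (eq_of_mem_of_mem hD (h.A_mem n) hx h1)
  have hxB : x ∉ B n := fun h1 => hB (eq_of_mem_of_mem hD (h.B_mem n) hx h1)
  cases n with
  | zero => exact absurd (h.mem_zero_or_mem_zero x) (by tauto)
  | succ m =>
    have hxS : x ∉ S m := fun h1 => absurd (h.mem_or_mem h1) (by tauto)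
    refine ⟨m, rfl, ⟨x, ?_⟩, fun e => hxS (e ▸ hx)⟩
    rw [eq_ballClass hD hx]
    exact Set.ext fun y => ⟨fun hy => h.mono (by omega) hy, fun hy => h.ballEquiv_succ hxS hy⟩

theorem exists_adj_of_ballEquiv (h : SpecialFrame G φ S A B) (hD : D ∈ ballClasses G φ n)
    (hxy : BallEquiv G φ (n + 1) x y) (hx : ∃ z, G.Adj x z ∧ z ∈ D) :
    ∃ z, G.Adj y z ∧ z ∈ D := by
  obtain ⟨w, rfl⟩ := hD
  rw [← nbrCount_pos_iff h.fin] at hx ⊢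
  rwa [← hxy.nbrCount_eq h.tree.connected h.fin w]

theorem alwaysAdjTo_of_mem_succ (h : SpecialFrame G φ S A B)
    (hD : D ∈ ballClasses G φ (n + 1)) (hD' : D' ∈ ballClasses G φ n)
    (hadj : CanAdj G D D') : AlwaysAdjTo G D D' := by
  obtain ⟨x, hx, z, hz, hxz⟩ := hadj
  exact fun y hy => h.exists_adj_of_ballEquiv hD' ((mem_iff_ballEquiv hD hx).1 hy) ⟨z, hxz, hz⟩

theorem alwaysAdjTo (h : SpecialFrame G φ S A B) (hD : D ∈ ballClasses G φ n)
    (hS : D ≠ S n) (hD' : D' ∈ ballClasses G φ n) (hadj : CanAdj G D D') :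
    AlwaysAdjTo G D D' :=
  h.alwaysAdjTo_of_mem_succ (h.mem_ballClasses_succ hD hS) hD' hadj

theorem nbrCount_eq_of_ne (h : SpecialFrame G φ S A B) (hD : D ∈ ballClasses G φ n)
    (hA : D ≠ A n) (hB : D ≠ B n) (hxy : BallEquiv G φ n x y) :
    nbrCount G x D = nbrCount G y D := by
  obtain ⟨m, rfl, ⟨w, rfl⟩, -⟩ := h.exists_eq_succ_of_ne hD hA hB
  exact hxy.nbrCount_eq h.tree.connected h.fin w

theorem canAdj_A_of_ne (h : SpecialFrame G φ S A B) (hD : D ∈ ballClasses G φ n)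
    (hA : D ≠ A n) (hB : D ≠ B n) (hadj : CanAdj G D (S n)) : CanAdj G D (A (n + 1)) := by
  obtain ⟨x, hx, s, hs, hxs⟩ := hadj
  obtain ⟨a, ha⟩ := nonempty_of_mem_ballClasses (h.A_mem (n + 1))
  have h1 := h.nbrCount_eq_of_ne hD hA hB
    ((mem_iff_ballEquiv (h.S_mem n) hs).1 (h.A_sub n ha))
  obtain ⟨z, hz, hzD⟩ := (nbrCount_pos_iff h.fin).1
    (h1 ▸ (nbrCount_pos_iff h.fin).2 ⟨x, hxs.symm, hx⟩)
  exact ⟨z, hzD, a, ha, hz.symm⟩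

theorem canAdj_B_of_ne (h : SpecialFrame G φ S A B) (hD : D ∈ ballClasses G φ n)
    (hA : D ≠ A n) (hB : D ≠ B n) (hadj : CanAdj G D (S n)) : CanAdj G D (B (n + 1)) :=
  h.swap.canAdj_A_of_ne hD hB hA hadj

theorem nbrCount_add (h : SpecialFrame G φ S A B) (x : V) (n : ℕ) :
    nbrCount G x (A (n + 1)) + nbrCount G x (B (n + 1)) = nbrCount G x (S n) := by
  have e : S n = A (n + 1) ∪ B (n + 1) := Set.Subset.antisymm (fun z hz => h.mem_or_mem hz)
    (Set.union_subset (h.A_sub n) (h.B_sub n))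
  rw [nbrCount, nbrCount, nbrCount, e, Set.inter_union_distrib_left, Set.ncard_union_eq _
    ((h.fin x).subset Set.inter_subset_left) ((h.fin x).subset Set.inter_subset_left)]
  exact Set.disjoint_left.2 fun z hz hz' => h.disjoint hz.2 hz'.2

theorem canAdj_S_A (h : SpecialFrame G φ S A B) (n : ℕ) :
    CanAdj G (S (n + 1)) (A (n + 1)) := by
  obtain ⟨x, hx⟩ := nonempty_of_mem_ballClasses (h.A_mem (n + 2))
  obtain ⟨y, hy⟩ := nonempty_of_mem_ballClasses (h.B_mem (n + 2))
  have hxS := h.A_sub (n + 1) hx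
  have hyS := h.B_sub (n + 1) hy
  have hxy : BallEquiv G φ (n + 1) x y := (mem_iff_ballEquiv (h.S_mem (n + 1)) hxS).1 hyS
  have hne : nbrCount G x (A (n + 1)) ≠ nbrCount G y (A (n + 1)) := by
    intro heq
    refine h.disjoint ((mem_iff_ballEquiv (h.A_mem (n + 2)) hx).2 ?_) hy
    refine NbrEquiv.ballEquiv h.tree h.fin ⟨hxy, fun w => ?_⟩
    have hw := ballClass_mem_ballClasses (G := G) (φ := φ) (n + 1) w
    by_cases hA : ballClass G φ (n + 1) w = A (n + 1)
    · rw [hA, heq]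
    by_cases hB : ballClass G φ (n + 1) w = B (n + 1)
    · have e := h.nbrCount_add x n
      have e' := h.nbrCount_add y n
      obtain ⟨s, hs⟩ := h.S_mem n
      have e'' := hxy.nbrCount_eq h.tree.connected h.fin s
      rw [← hs] at e''
      rw [hB]
      omega
    · exact h.nbrCount_eq_of_ne hw hA hB hxy
  by_cases hpos : 0 < nbrCount G x (A (n + 1))
  · obtain ⟨z, hz, hzA⟩ := (nbrCount_pos_iff h.fin).1 hpos
    exact ⟨x, hxS, z, hzA, hz⟩
  · obtain ⟨z, hz, hzA⟩ := (nbrCount_pos_iff (x := y) (D := A (n + 1)) h.fin).1 (by omega)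
    exact ⟨y, hyS, z, hzA, hz⟩

theorem canAdj_S_B (h : SpecialFrame G φ S A B) (n : ℕ) :
    CanAdj G (S (n + 1)) (B (n + 1)) :=
  h.swap.canAdj_S_A n

theorem eq_of_subset (h : SpecialFrame G φ S A B) {C : Set V} (hC : C ∈ ballClasses G φ n)
    (hSC : S (n + 1) ⊆ C) (hne : C ≠ S n) : S (n + 1) = C := by
  obtain ⟨x, hx⟩ := nonempty_of_mem_ballClasses (h.S_mem (n + 1))
  exact eq_of_mem_of_mem (h.S_mem _) (h.mem_ballClasses_succ hC hne) hx (hSC hx)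

theorem eq_or_eq_of_subset (h : SpecialFrame G φ S A B) (hSS : S (n + 1) ⊆ S n) :
    S (n + 1) = A (n + 1) ∨ S (n + 1) = B (n + 1) := by
  obtain ⟨x, hx⟩ := nonempty_of_mem_ballClasses (h.S_mem (n + 1))
  exact (h.mem_or_mem (hSS hx)).imp
    (fun h1 => eq_of_mem_of_mem (h.S_mem _) (h.A_mem _) hx h1)
    (fun h1 => eq_of_mem_of_mem (h.S_mem _) (h.B_mem _) hx h1)

end SpecialFrame

theorem Labeling.specialFrame {V α : Type} {G : SimpleGraph V} {φ : V → α} {d : ℕ}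
    (hd : 0 < d) (hT : IsRegularTree G d) (hSt : IsSturmian G φ) {a b : α} (hab : a ≠ b)
    (L : Labeling G φ a b) : SpecialFrame G φ L.S L.A L.B where
  tree := hT.isTree
  fin v := Set.finite_of_ncard_pos (by rw [hT.regular v]; exact hd)
  regular v w := by rw [hT.regular, hT.regular]
  sturm := hSt
  S_mem n := by
    obtain ⟨x, hx, -⟩ := L.S_special n
    exact ⟨x, hx⟩
  A_mem n := by
    cases n with
    | zero =>
      obtain ⟨x, -, hx⟩ := L.A0_col
      exact ⟨x, hx⟩
    | succ n =>
      obtain ⟨x, -, -, hx⟩ := L.A_ext n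
      exact ⟨x, hx⟩
  B_mem n := by
    cases n with
    | zero =>
      obtain ⟨x, -, hx⟩ := L.B0_col
      exact ⟨x, hx⟩
    | succ n =>
      obtain ⟨x, -, -, hx⟩ := L.B_ext n
      exact ⟨x, hx⟩
  AB_ne n := by
    cases n with
    | zero =>
      obtain ⟨x, hxa, hx⟩ := L.A0_col
      obtain ⟨y, hyb, hy⟩ := L.B0_col
      intro e
      have hxy : BallEquiv G φ 0 x y := by
        rw [← mem_ballClass, ← hx, e, hy]
        exact self_mem_ballClass 0 y
      exact hab (by rw [← hxa, ← hyb, hxy.color_eq_s17])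
    | succ n => exact L.AB_ne n
  A_sub n := by
    obtain ⟨x, -, hS, hA⟩ := L.A_ext n
    rw [hS, hA]
    exact fun y hy => hy.mono hT.isTree.connected (by omega)
  B_sub n := by
    obtain ⟨x, -, hS, hB⟩ := L.B_ext n
    rw [hS, hB]
    exact fun y hy => hy.mono hT.isTree.connected (by omega)
  A_adj := L.A_adj
  B_adj := L.B_adj

/-! ### No vertex has three inequivalent neighbors -/

/-- `v` has three neighbors whose `n`-balls are pairwise inequivalent and not equivalent
to the one of `v`. -/
def HasThreeNbrs {V α : Type} (G : SimpleGraph V) (φ : V → α) (n : ℕ) (v : V) : Prop :=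
  ∃ x y z, G.Adj v x ∧ G.Adj v y ∧ G.Adj v z ∧
    ¬ BallEquiv G φ n v x ∧ ¬ BallEquiv G φ n v y ∧ ¬ BallEquiv G φ n v z ∧
    ¬ BallEquiv G φ n x y ∧ ¬ BallEquiv G φ n x z ∧ ¬ BallEquiv G φ n y z

section Near

variable {V α : Type} {G : SimpleGraph V} {φ : V → α}

theorem HasThreeNbrs.mono (hc : G.Connected) {m n : ℕ} (hmn : m ≤ n) {v : V}
    (h : HasThreeNbrs G φ m v) : HasThreeNbrs G φ n v := by
  have key : ∀ u w, ¬ BallEquiv G φ m u w → ¬ BallEquiv G φ n u w :=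
    fun u w h h' => h (h'.mono hc hmn)
  obtain ⟨x, y, z, hx, hy, hz, h1, h2, h3, h4, h5, h6⟩ := h
  exact ⟨x, y, z, hx, hy, hz, key _ _ h1, key _ _ h2, key _ _ h3, key _ _ h4, key _ _ h5,
    key _ _ h6⟩

theorem HasThreeNbrs.false_of_cover {n : ℕ} {v : V} (h : HasThreeNbrs G φ n v)
    {P Q : V → Prop} (hcov : ∀ y, G.Adj v y → ¬ BallEquiv G φ n v y → P y ∨ Q y)
    (hP : ∀ y z, P y → P z → BallEquiv G φ n y z)
    (hQ : ∀ y z, Q y → Q z → BallEquiv G φ n y z) : False := by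
  obtain ⟨x, y, z, hx, hy, hz, h1, h2, h3, h4, h5, h6⟩ := h
  rcases hcov x hx h1 with a | a <;> rcases hcov y hy h2 with b | b <;>
    rcases hcov z hz h3 with c | c <;>
    first
    | exact h4 (hP _ _ a b)
    | exact h5 (hP _ _ a c)
    | exact h6 (hP _ _ b c)
    | exact h4 (hQ _ _ a b)
    | exact h5 (hQ _ _ a c)
    | exact h6 (hQ _ _ b c)

/-- The vertices at distance at most `r` from `F`. -/
def near (G : SimpleGraph V) (F : Set V) : ℕ → Set V
  | 0 => F
  | r + 1 => near G F r ∪ {u | ∃ w ∈ near G F r, G.Adj w u}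

theorem near_subset_succ (F : Set V) (r : ℕ) : near G F r ⊆ near G F (r + 1) :=
  Set.subset_union_left

theorem near_mono (F : Set V) : Monotone (near G F) :=
  monotone_nat_of_le_succ (near_subset_succ F)

theorem mem_near_succ_of_adj {F : Set V} {r : ℕ} {u w : V} (hw : w ∈ near G F r)
    (h : G.Adj w u) : u ∈ near G F (r + 1) :=
  Or.inr ⟨w, hw, h⟩

theorem near_finite (hfin : ∀ v, (G.neighborSet v).Finite) {F : Set V} (hF : F.Finite)
    (r : ℕ) : (near G F r).Finite := by
  induction r with
  | zero => exact hF
  | succ r ih =>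
    refine ih.union ((ih.biUnion fun w _ => hfin w).subset ?_)
    rintro u ⟨w, hw, hu⟩
    exact Set.mem_biUnion hw hu

theorem exists_mem_near (hc : G.Connected) {F : Set V} (hF : F.Nonempty) (v : V) :
    ∃ r, v ∈ near G F r := by
  obtain ⟨w, hw⟩ := hF
  obtain ⟨p⟩ := hc w v
  have key : ∀ u v (_ : G.Walk u v), (∃ r, u ∈ near G F r) → ∃ r, v ∈ near G F r := by
    intro u v p
    induction p with
    | nil => exact id
    | cons h p ih =>
      rintro ⟨r, hr⟩
      exact ih ⟨r + 1, mem_near_succ_of_adj hr h⟩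
  exact key w v p ⟨0, hw⟩

theorem exists_adj_mem_notMem (hc : G.Connected) {U : Set V} {u w : V} (hu : u ∈ U)
    (hw : w ∉ U) : ∃ x ∈ U, ∃ y, y ∉ U ∧ G.Adj x y := by
  by_contra! hcon
  have key : ∀ r, near G {u} r ⊆ U := by
    intro r
    induction r with
    | zero => exact Set.singleton_subset_iff.2 hu
    | succ r ih =>
      rintro z (hz | ⟨x, hx, hxz⟩)
      · exact ih hz
      · by_contra hzU
        exact hcon x (ih hx) z hzU hxz
  obtain ⟨r, hr⟩ := exists_mem_near hc (Set.singleton_nonempty u) w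
  exact hw (key r hr)

end Near

/-- `U` is a union of classes of `m`-balls containing `A m` but neither `B m` nor `S m`,
such that all edges leaving `U` lead from `A m` to `S m`. -/
structure IsBlock {V α : Type} (G : SimpleGraph V) (φ : V → α) (S A B : ℕ → Set V) (m : ℕ)
    (U : Set V) : Prop where
  sat : ∀ x y, x ∈ U → BallEquiv G φ m x y → y ∈ U
  A_sub : A m ⊆ U
  B_notMem : ∀ x ∈ B m, x ∉ U
  S_notMem : ∀ x ∈ S m, x ∉ U
  edge : ∀ x ∈ U, ∀ y, y ∉ U → G.Adj x y → x ∈ A m ∧ y ∈ S m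

namespace SpecialFrame

variable {V α : Type} {G : SimpleGraph V} {φ : V → α} {S A B : ℕ → Set V}
  {m n : ℕ} {x y : V} {D D' : Set V}

theorem isBlock_diff (h : SpecialFrame G φ S A B) {U : Set V}
    (hU : IsBlock G φ S A B (m + 1) U) (hne : (U \ A (m + 1)).Nonempty) :
    IsBlock G φ S A B m (U \ A (m + 1)) := by
  have hS : ∀ x ∈ S m, x ∉ U \ A (m + 1) := fun x hx hxU =>
    (h.mem_or_mem hx).elim hxU.2 fun hB => hU.B_notMem x hB hxU.1
  have hsat : ∀ x y, x ∈ U \ A (m + 1) → BallEquiv G φ m x y → y ∈ U \ A (m + 1) := by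
    intro x y hx hxy
    have h1 := h.ballEquiv_succ (fun h1 => hS x h1 hx) hxy
    exact ⟨hU.sat x y hx.1 h1, fun h2 =>
      hx.2 ((mem_iff_ballEquiv (h.A_mem _) h2).2 h1.symm)⟩
  have hBadj : ∀ x ∈ U \ A (m + 1), ∀ y ∈ B (m + 1), ¬ G.Adj x y := fun x hx y hy hadj =>
    hx.2 (hU.edge x hx.1 y (hU.B_notMem y hy) hadj).1
  have hB : ∀ x ∈ B m, x ∉ U \ A (m + 1) := by
    intro x hx hxU
    obtain ⟨b, hb⟩ := nonempty_of_mem_ballClasses (h.B_mem (m + 1))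
    obtain ⟨u, hu, huB⟩ := h.B_adj m b hb
    exact hBadj u (hsat x u hxU ((mem_iff_ballEquiv (h.B_mem m) hx).1 huB)) b hb hu.symm
  have hedge : ∀ x ∈ U \ A (m + 1), ∀ y, y ∉ U \ A (m + 1) → G.Adj x y →
      x ∈ A m ∧ y ∈ S m := by
    intro x hx y hy hxy
    have hyU : y ∈ U := by
      by_contra hyU
      exact hx.2 (hU.edge x hx.1 y hyU hxy).1
    have hyA : y ∈ A (m + 1) := by
      by_contra hyA
      exact hy ⟨hyU, hyA⟩
    have hyS := h.A_sub m hyA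
    refine ⟨?_, hyS⟩
    by_contra hxA
    obtain ⟨u, hu, b, hb, hadj⟩ := h.canAdj_B_of_ne (ballClass_mem_ballClasses m x)
      (fun e => hxA (e ▸ self_mem_ballClass m x))
      (fun e => hB x (e ▸ self_mem_ballClass m x) hx)
      ⟨x, self_mem_ballClass m x, y, hyS, hxy⟩
    exact hBadj u (hsat x u hx hu) b hb hadj
  refine ⟨hsat, ?_, hB, hS, hedge⟩
  obtain ⟨u, hu⟩ := hne
  obtain ⟨a, ha⟩ := nonempty_of_mem_ballClasses (h.A_mem (m + 1))
  obtain ⟨x, hx, y, hy, hxy⟩ := exists_adj_mem_notMem h.tree.connected hu (fun h1 => h1.2 ha)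
  exact fun z hz => hsat x z hx ((mem_iff_ballEquiv (h.A_mem m) (hedge x hx y hy hxy).1).1 hz)

theorem not_hasThreeNbrs_of_isBlock (h : SpecialFrame G φ S A B) {U : Set V}
    (hU : IsBlock G φ S A B m U) : (∀ u ∈ U, ¬ HasThreeNbrs G φ m u) ∧
      ∀ a ∈ A m, ∀ a' ∈ A m, ∀ y ∈ U \ A m, ∀ z ∈ U \ A m, G.Adj a y → G.Adj a' z →
        BallEquiv G φ m y z := by
  have hAA : ∀ m, ∀ y z, y ∈ A m → z ∈ A m → BallEquiv G φ m y z :=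
    fun m y z hy hz => (mem_iff_ballEquiv (h.A_mem m) hy).1 hz
  have hSS : ∀ m, ∀ y z, y ∈ S m → z ∈ S m → BallEquiv G φ m y z :=
    fun m y z hy hz => (mem_iff_ballEquiv (h.S_mem m) hy).1 hz
  induction m generalizing U with
  | zero =>
    have hUA : ∀ u ∈ U, u ∈ A 0 := fun u hu =>
      (h.mem_zero_or_mem_zero u).resolve_right fun h1 => hU.B_notMem u h1 hu
    refine ⟨fun u hu h3 => ?_, fun _ _ _ _ y hy => absurd (hUA y hy.1) hy.2⟩
    have hBB : ∀ y z, y ∈ B 0 → z ∈ B 0 → BallEquiv G φ 0 y z :=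
      fun y z hy hz => (mem_iff_ballEquiv (h.B_mem 0) hy).1 hz
    exact h3.false_of_cover (fun y _ _ => h.mem_zero_or_mem_zero y) (hAA 0) hBB
  | succ m ih =>
    rcases (U \ A (m + 1)).eq_empty_or_nonempty with hemp | hne
    · have hUA : ∀ u ∈ U, u ∈ A (m + 1) := fun u hu => by
        by_contra h1
        exact (Set.ext_iff.1 hemp u).1 ⟨hu, h1⟩
      refine ⟨fun u hu h3 => ?_, fun _ _ _ _ y hy => absurd (hUA y hy.1) hy.2⟩
      refine h3.false_of_cover (fun y hy _ => ?_) (hAA (m + 1)) (hSS (m + 1))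
      by_cases hyU : y ∈ U
      · exact Or.inl (hUA y hyU)
      · exact Or.inr (hU.edge u hu y hyU hy).2
    · have hU' := h.isBlock_diff hU hne
      obtain ⟨ih1, ih2⟩ := ih hU'
      have hlift : ∀ y z, y ∈ U \ A (m + 1) → BallEquiv G φ m y z →
          BallEquiv G φ (m + 1) y z :=
        fun y z hy hyz => h.ballEquiv_succ (fun h1 => hU'.S_notMem y h1 hy) hyz
      have hedge : ∀ a ∈ A (m + 1), ∀ y ∈ U \ A (m + 1), G.Adj a y → y ∈ A m :=
        fun a ha y hy hay => (hU'.edge y hy a (fun h1 => h1.2 ha) hay.symm).1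
      refine ⟨fun u hu h3 => ?_, fun a ha a' ha' y hy z hz h1 h2 =>
        hlift y z hy (hAA m y z (hedge a ha y hy h1) (hedge a' ha' z hz h2))⟩
      by_cases huA : u ∈ A (m + 1)
      · refine h3.false_of_cover (P := fun y => y ∈ A m) (Q := fun y => y ∈ S (m + 1))
          (fun y hy hne => ?_)
          (fun y z hy hz => hlift y z (hU'.A_sub hy) (hAA m y z hy hz)) (hSS (m + 1))
        by_cases hyU : y ∈ U
        · exact Or.inl (hedge u huA y ⟨hyU, fun h1 => hne (hAA _ u y huA h1)⟩ hy)
        · exact Or.inr (hU.edge u hu y hyU hy).2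
      · have hyU : ∀ y, G.Adj u y → y ∈ U := fun y hy => by
          by_contra h1
          exact huA (hU.edge u hu y h1 hy).1
        have huU : u ∈ U \ A (m + 1) := ⟨hu, huA⟩
        by_cases huA' : u ∈ A m
        · refine h3.false_of_cover (P := fun y => y ∈ A (m + 1))
            (Q := fun y => G.Adj u y ∧ y ∈ (U \ A (m + 1)) \ A m)
            (fun y hy hne => ?_) (hAA (m + 1))
            (fun y z hy hz => hlift y z hy.2.1 (ih2 u huA' u huA' y hy.2 z hz.2 hy.1 hz.1))
          by_cases hyA : y ∈ A (m + 1)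
          · exact Or.inl hyA
          · exact Or.inr ⟨hy, ⟨hyU y hy, hyA⟩, fun h1 => hne (hlift u y huU (hAA m u y huA' h1))⟩
        · have hyU' : ∀ y, G.Adj u y → y ∈ U \ A (m + 1) := fun y hy =>
            ⟨hyU y hy, fun h1 => huA' (hedge y h1 u huU hy.symm)⟩
          obtain ⟨x, y, z, hx, hy, hz, h1, h2, h3, h4, h5, h6⟩ := h3
          refine ih1 u huU ⟨x, y, z, hx, hy, hz, fun e => h1 (hlift _ _ huU e),
            fun e => h2 (hlift _ _ huU e), fun e => h3 (hlift _ _ huU e),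
            fun e => h4 (hlift _ _ (hyU' x hx) e), fun e => h5 (hlift _ _ (hyU' x hx) e),
            fun e => h6 (hlift _ _ (hyU' y hy) e)⟩

/-- The relation coarser than `BallEquiv G φ M` by one step. -/
def CoarseEquiv (G : SimpleGraph V) (φ : V → α) : ℕ → V → V → Prop
  | 0, _, _ => True
  | M + 1, x, y => BallEquiv G φ M x y

theorem coarseEquiv_equivalence (M : ℕ) : Equivalence (CoarseEquiv G φ M) := by
  cases M with
  | zero => exact ⟨fun _ => trivial, fun _ => trivial, fun _ _ => trivial⟩
  | succ M => exact ballEquiv_equivalence M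

theorem coarseEquiv_of_ballEquiv (h : SpecialFrame G φ S A B) {M : ℕ}
    (hxy : BallEquiv G φ M x y) : CoarseEquiv G φ M x y := by
  cases M with
  | zero => trivial
  | succ M => exact h.mono (by omega) hxy

theorem ballEquiv_of_coarseEquiv (h : SpecialFrame G φ S A B) {M : ℕ} (hx : x ∉ A M)
    (hy : y ∉ A M) (hxy : CoarseEquiv G φ M x y) : BallEquiv G φ M x y := by
  cases M with
  | zero =>
    exact (mem_iff_ballEquiv (h.B_mem 0) ((h.mem_zero_or_mem_zero x).resolve_left hx)).1
      ((h.mem_zero_or_mem_zero y).resolve_left hy)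
  | succ M => exact h.swap.ballEquiv_succ_of_notMem hxy hx hy

theorem nbrCount_coarseEquiv (h : SpecialFrame G φ S A B) {M : ℕ}
    (hxy : BallEquiv G φ M x y) (w : V) :
    nbrCount G x {z | CoarseEquiv G φ M w z} = nbrCount G y {z | CoarseEquiv G φ M w z} := by
  cases M with
  | zero => simpa [nbrCount, CoarseEquiv] using h.regular x y
  | succ M => exact hxy.nbrCount_eq h.tree.connected h.fin w

theorem ballEquiv_of_notMem_near (h : SpecialFrame G φ S A B) {M : ℕ} (r : ℕ) {u v : V}
    (hu : u ∉ near G (A M) r) (hv : v ∉ near G (A M) r) (huv : CoarseEquiv G φ M u v) :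
    BallEquiv G φ (M + r) u v := by
  induction r generalizing u v with
  | zero => exact h.ballEquiv_of_coarseEquiv hu hv huv
  | succ r ih =>
    have hu' : u ∉ near G (A M) r := fun h1 => hu (near_subset_succ _ _ h1)
    have hv' : v ∉ near G (A M) r := fun h1 => hv (near_subset_succ _ _ h1)
    have huvE := ih hu' hv' huv
    have hnb : ∀ u, u ∉ near G (A M) (r + 1) → ∀ z, G.Adj u z → z ∉ near G (A M) r :=
      fun u hu z hz h1 => hu (mem_near_succ_of_adj h1 hz.symm)
    refine NbrEquiv.ballEquiv (n := M + r + 1) h.tree h.fin ⟨huvE, fun w => ?_⟩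
    have key : ∀ z ∈ ballClass G φ (M + r) w, z ∉ near G (A M) r → ∀ u,
        u ∉ near G (A M) (r + 1) → nbrCount G u (ballClass G φ (M + r) w) =
        nbrCount G u {z' | CoarseEquiv G φ M z z'} := by
      intro z hz hzn u hu
      unfold nbrCount
      congr 1
      ext t
      constructor
      · rintro ⟨ht, htw⟩
        exact ⟨ht, h.coarseEquiv_of_ballEquiv
          (h.mono (by omega) ((BallEquiv.symm hz).trans htw))⟩
      · rintro ⟨ht, htz⟩
        exact ⟨ht, BallEquiv.trans hz (ih hzn (hnb u hu t ht) htz)⟩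
    have hcoarse := h.nbrCount_coarseEquiv (h.mono (show M ≤ M + r by omega) huvE)
    by_cases hex : ∃ z ∈ ballClass G φ (M + r) w, G.Adj u z ∨ G.Adj v z
    · obtain ⟨z, hz, hadj⟩ := hex
      have hzn : z ∉ near G (A M) r := hadj.elim (hnb u hu z) (hnb v hv z)
      rw [key z hz hzn u hu, key z hz hzn v hv, hcoarse z]
    · have h0 : ∀ x, (x = u ∨ x = v) → nbrCount G x (ballClass G φ (M + r) w) = 0 := by
        intro x hx
        rw [← Nat.le_zero, ← not_lt, nbrCount_pos_iff h.fin]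
        rintro ⟨z, hz, hzw⟩
        exact hex ⟨z, hzw, by rcases hx with rfl | rfl <;> tauto⟩
      rw [h0 u (Or.inl rfl), h0 v (Or.inr rfl)]

theorem near_saturated (h : SpecialFrame G φ S A B) {M : ℕ} {F : Set V}
    (hF : F ∈ ballClasses G φ M) (r : ℕ) {u v : V} (hu : u ∈ near G F r)
    (huv : BallEquiv G φ (M + r) u v) : v ∈ near G F r := by
  induction r generalizing u v with
  | zero => exact (mem_iff_ballEquiv hF hu).2 huv
  | succ r ih =>
    rcases hu with hu | ⟨w, hw, hwu⟩
    · exact near_subset_succ _ _ (ih hu (h.mono (by omega) huv))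
    · obtain ⟨w', hw', hww'⟩ := h.exists_adj_of_ballEquiv (n := M + r)
        (ballClass_mem_ballClasses _ w) huv ⟨w, hwu.symm, self_mem_ballClass _ w⟩
      exact mem_near_succ_of_adj (ih hw hww') hw'.symm

theorem exists_coarseEquiv_notMem_near (h : SpecialFrame G φ S A B) (M : ℕ) (F : Set V) :
    ∃ r₀, ∀ r ≥ r₀, ∀ u, u ∉ near G F r →
      ∃ u', u' ∉ near G F (r + 1) ∧ CoarseEquiv G φ M u u' := by
  have hex : ∀ u, ∃ r, (∀ s, ∃ u', u' ∉ near G F s ∧ CoarseEquiv G φ M u u') ∨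
      ∀ u', CoarseEquiv G φ M u u' → u' ∈ near G F r := by
    intro u
    by_cases hu : ∀ s, ∃ u', u' ∉ near G F s ∧ CoarseEquiv G φ M u u'
    · exact ⟨0, Or.inl hu⟩
    · push Not at hu
      obtain ⟨s, hs⟩ := hu
      exact ⟨s, Or.inr fun u' hu' => by_contra fun h1 => hs u' h1 hu'⟩
  choose ρ hρ using hex
  let rep : Set V → V := fun D => if hD : D.Nonempty then hD.some
    else h.tree.connected.nonempty.some
  obtain ⟨r₀, hr₀⟩ := ((h.finite_ballClasses M).image (fun D => ρ (rep D))).bddAbove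
  refine ⟨r₀, fun r hr u hu => ?_⟩
  have hne : (ballClass G φ M u).Nonempty := ⟨u, self_mem_ballClass M u⟩
  have hrep : BallEquiv G φ M u (rep (ballClass G φ M u)) := by
    simp only [rep, hne, dif_pos]
    exact hne.some_mem
  have hle := hr₀ ⟨_, ballClass_mem_ballClasses M u, rfl⟩
  have hco := h.coarseEquiv_of_ballEquiv hrep
  have heq := coarseEquiv_equivalence (G := G) (φ := φ) M
  rcases hρ (rep (ballClass G φ M u)) with h1 | h1
  · obtain ⟨u', hu', hc⟩ := h1 (r + 1)
    exact ⟨u', hu', heq.trans hco hc⟩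
  · exact absurd (near_mono F (le_trans hle hr) (h1 u (heq.symm hco))) hu

theorem not_hasThreeNbrs_of_unbounded (h : SpecialFrame G φ S A B) {M : ℕ}
    (hunb : ∀ r, ∃ u, u ∉ near G (A M) r) (n : ℕ) (v : V) : ¬ HasThreeNbrs G φ n v := by
  have hc := h.tree.connected
  have hF := h.A_mem M
  obtain ⟨r₀, hr₀⟩ := h.exists_coarseEquiv_notMem_near M (A M)
  have hsat := fun r (u v : V) => h.near_saturated hF r (u := u) (v := v)
  have hpair : ∀ r ≥ r₀, ∀ u, u ∉ near G (A M) r → ∃ u', u' ∉ near G (A M) (r + 1) ∧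
      BallEquiv G φ (M + r) u u' := by
    intro r hr u hu
    obtain ⟨u', hu', hco⟩ := hr₀ r hr u hu
    exact ⟨u', hu', h.ballEquiv_of_notMem_near r hu
      (fun h1 => hu' (near_subset_succ _ _ h1)) hco⟩
  have hspec : ∀ r ≥ r₀, ∀ u ∈ near G (A M) (r + 1), u ∉ near G (A M) r →
      u ∈ S (M + r) := by
    intro r hr u hu hu'
    obtain ⟨u', h1, h2⟩ := hpair r hr u hu'
    by_contra hS
    exact h1 (hsat (r + 1) u u' hu (h.ballEquiv_succ hS h2))
  have hshell : ∀ r, ∃ u ∈ near G (A M) (r + 1), u ∉ near G (A M) r := by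
    intro r
    obtain ⟨w, hw⟩ := hunb r
    obtain ⟨a, ha⟩ := nonempty_of_mem_ballClasses hF
    obtain ⟨x, hx, y, hy, hxy⟩ := exists_adj_mem_notMem hc
      (near_mono (G := G) (A M) (Nat.zero_le r) ha) hw
    exact ⟨y, mem_near_succ_of_adj hx hxy, hy⟩
  have hblock : ∀ r ≥ r₀, ∀ (A' B' : ℕ → Set V), SpecialFrame G φ S A' B' →
      (∃ u ∈ A' (M + r + 1), u ∈ near G (A M) (r + 1) ∧ u ∉ near G (A M) r) →
      IsBlock G φ S A' B' (M + r + 1) (near G (A M) (r + 1)) := by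
    rintro r hr A' B' h' ⟨u, huA, hu, hu'⟩
    have huS := h'.A_sub _ huA
    obtain ⟨u', hu'n, huu'⟩ := hpair r hr u hu'
    have hAn : A' (M + r + 1) ⊆ near G (A M) (r + 1) := fun z hz =>
      hsat (r + 1) u z hu ((mem_iff_ballEquiv (h'.A_mem _) huA).1 hz)
    have hu'B : u' ∈ B' (M + r + 1) :=
      (h'.mem_or_mem ((mem_iff_ballEquiv (h'.S_mem _) huS).2 huu')).resolve_left
        fun h1 => hu'n (hAn h1)
    have hBn : ∀ z ∈ B' (M + r + 1), z ∉ near G (A M) (r + 1) := fun z hz h1 =>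
      hu'n (hsat (r + 1) z u' h1 ((mem_iff_ballEquiv (h'.B_mem _) hz).1 hu'B))
    refine ⟨hsat (r + 1), hAn, hBn, ?_, ?_⟩
    · intro z hz h1
      obtain ⟨t, ht, ht'⟩ := hshell (r + 1)
      have htS := hspec (r + 1) (by omega) t ht ht'
      exact ht' (hsat (r + 1) z t h1 ((mem_iff_ballEquiv (h.S_mem _) hz).1 htS))
    · intro z hz w hw hzw
      have hz' : z ∉ near G (A M) r := fun h1 => hw (mem_near_succ_of_adj h1 hzw)
      refine ⟨?_, hspec (r + 1) (by omega) w (mem_near_succ_of_adj hz hzw) hw⟩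
      exact (h'.mem_or_mem (hspec r hr z hz hz')).resolve_right fun h1 => hBn z h1 hz
  intro h3
  obtain ⟨r, hr⟩ := exists_mem_near hc (nonempty_of_mem_ballClasses hF) v
  let s := max (max r₀ n) r
  have hv : v ∈ near G (A M) (s + 1) := near_mono (A M) (by omega) hr
  have h3' := h3.mono hc (show n ≤ M + s + 1 by omega)
  obtain ⟨u, hu, hu'⟩ := hshell s
  rcases h.mem_or_mem (hspec s (by omega) u hu hu') with hA | hB
  · exact (h.not_hasThreeNbrs_of_isBlock (hblock s (by omega) A B h ⟨u, hA, hu, hu'⟩)).1 v hv h3'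
  · exact (h.swap.not_hasThreeNbrs_of_isBlock
      (hblock s (by omega) B A h.swap ⟨u, hB, hu, hu'⟩)).1 v hv h3'

theorem exists_eq_A_or_eq_B (h : SpecialFrame G φ S A B) (hD : D ∈ ballClasses G φ n) :
    ∃ M, D = A M ∨ D = B M := by
  induction n with
  | zero =>
    by_contra! hcon
    obtain ⟨m, hm, -⟩ := h.exists_eq_succ_of_ne hD (hcon 0).1 (hcon 0).2
    omega
  | succ n ih =>
    by_cases hA : D = A (n + 1)
    · exact ⟨_, Or.inl hA⟩
    by_cases hB : D = B (n + 1)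
    · exact ⟨_, Or.inr hB⟩
    obtain ⟨m, hm, hDm, -⟩ := h.exists_eq_succ_of_ne hD hA hB
    obtain rfl : n = m := by omega
    exact ih hDm

theorem not_hasThreeNbrs_of_stable (h : SpecialFrame G φ S A B) {v : V} {N : ℕ}
    (hv : ∀ m ≥ N, v ∉ S m) (n : ℕ) (w : V) : ¬ HasThreeNbrs G φ n w := by
  by_cases hunb : ∀ r, ∃ u, u ∉ near G (ballClass G φ N v) r
  · obtain ⟨M, e | e⟩ := h.exists_eq_A_or_eq_B (ballClass_mem_ballClasses N v)
    · rw [e] at hunb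
      exact h.not_hasThreeNbrs_of_unbounded hunb n w
    · rw [e] at hunb
      exact h.swap.not_hasThreeNbrs_of_unbounded hunb n w
  · exfalso
    push Not at hunb
    obtain ⟨R, hR⟩ := hunb
    have hstab : ∀ k, ∀ u ∈ ballClass G φ N v, BallEquiv G φ (N + k) v u := by
      intro k u hu
      induction k with
      | zero => exact hu
      | succ k ih => exact h.ballEquiv_succ (hv (N + k) (by omega)) ih
    have hnear : ∀ r k, ∀ u ∈ near G (ballClass G φ N v) r,
        ∃ u' ∈ near G {v} r, BallEquiv G φ (N + k) u' u := by
      intro r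
      induction r with
      | zero => exact fun k u hu => ⟨v, rfl, hstab k u hu⟩
      | succ r ih =>
        rintro k u (hu | ⟨w, hw, hwu⟩)
        · obtain ⟨u', hu', e⟩ := ih k u hu
          exact ⟨u', near_subset_succ _ _ hu', e⟩
        · obtain ⟨w', hw', e⟩ := ih (k + 1) w hw
          obtain ⟨u', h1, h2⟩ := h.exists_adj_of_ballEquiv (n := N + k)
            (ballClass_mem_ballClasses _ u) e.symm ⟨u, hwu, self_mem_ballClass _ u⟩
          exact ⟨u', mem_near_succ_of_adj hw' h1, BallEquiv.symm h2⟩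
    have hfin := near_finite h.fin (Set.finite_singleton v) R
    have hle : ∀ k, N + k + 2 ≤ (near G {v} R).ncard := by
      intro k
      rw [← h.sturm (N + k)]
      refine le_trans (Set.ncard_le_ncard ?_ (hfin.image (ballClass G φ (N + k))))
        (Set.ncard_image_le hfin)
      rintro D ⟨u, rfl⟩
      obtain ⟨u', hu', e⟩ := hnear R k u (hR u)
      exact ⟨u', hu', ballClass_eq_of_ballEquiv e⟩
    have := hle (near G {v} R).ncard
    omega

theorem exists_not_adj_both (h : SpecialFrame G φ S A B) (x : V) :
    ∃ N, ∀ m ≥ N, ∀ y ∈ A (m + 1), ∀ z ∈ B (m + 1), G.Adj x y → ¬ G.Adj x z := by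
  have hex : ∀ p : V × V, ∃ N, (∃ m ≤ N, ¬ BallEquiv G φ m p.1 p.2) ∨
      ∀ m, BallEquiv G φ m p.1 p.2 := by
    intro p
    by_cases hp : ∀ m, BallEquiv G φ m p.1 p.2
    · exact ⟨0, Or.inr hp⟩
    · push Not at hp
      obtain ⟨m, hm⟩ := hp
      exact ⟨m, Or.inl ⟨m, le_rfl, hm⟩⟩
  choose ν hν using hex
  obtain ⟨N, hN⟩ := ((((h.fin x).prod (h.fin x))).image ν).bddAbove
  refine ⟨N, fun m hm y hy z hz hxy hxz => ?_⟩
  have hle : ν (y, z) ≤ N := hN ⟨(y, z), ⟨hxy, hxz⟩, rfl⟩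
  rcases hν (y, z) with ⟨k, hk, hne⟩ | hall
  · have : BallEquiv G φ m y z :=
      (mem_iff_ballEquiv (h.S_mem m) (h.A_sub m hy)).1 (h.B_sub m hz)
    exact hne (h.mono (by omega) this)
  · exact h.disjoint ((mem_iff_ballEquiv (h.A_mem _) hy).2 (hall _)) hz

theorem false_of_mem_A_of_cover (h : SpecialFrame G φ S A B) {v : V}
    (hv : v ∈ A (m + 1)) (h3 : HasThreeNbrs G φ m v)
    (hboth : ∀ y, G.Adj v y →
      ∀ a ∈ A (m + 1), ∀ b ∈ B (m + 1), G.Adj y a → ¬ G.Adj y b) : False := by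
  have hvS := h.A_sub m hv
  have hno : ∀ y, G.Adj v y → ¬ BallEquiv G φ m v y → y ∉ S (m + 1) →
      CanAdj G (ballClass G φ m y) (A (m + 1)) →
      CanAdj G (ballClass G φ m y) (B (m + 1)) → False := by
    intro y hy hne hyS hA hB
    have hD := h.mem_ballClasses_succ (ballClass_mem_ballClasses m y) fun e =>
      hne ((mem_iff_ballEquiv (h.S_mem m) hvS).1 (e ▸ self_mem_ballClass m y))
    have hDS : ballClass G φ m y ≠ S (m + 1) := fun e => hyS (e ▸ self_mem_ballClass m y)
    obtain ⟨a, hya, ha⟩ := h.alwaysAdjTo hD hDS (h.A_mem _) hA y (self_mem_ballClass m y)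
    obtain ⟨b, hyb, hb⟩ := h.alwaysAdjTo hD hDS (h.B_mem _) hB y (self_mem_ballClass m y)
    exact hboth y hy a ha b hb hya hyb
  refine h3.false_of_cover (P := fun y => y ∈ A m) (Q := fun y => y ∈ S (m + 1)) ?_
    (fun y z hy hz => (mem_iff_ballEquiv (h.A_mem m) hy).1 hz)
    (fun y z hy hz => h.mono (by omega) ((mem_iff_ballEquiv (h.S_mem _) hy).1 hz))
  intro y hy hne
  by_contra! hcon
  obtain ⟨hyA, hyS⟩ := hcon
  have hself := self_mem_ballClass (G := G) (φ := φ) m y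
  have hcls := ballClass_mem_ballClasses (G := G) (φ := φ) m y
  have hDA : ballClass G φ m y ≠ A m := fun e => hyA (e ▸ hself)
  have hadj : CanAdj G (ballClass G φ m y) (A (m + 1)) := ⟨y, hself, v, hv, hy.symm⟩
  refine hno y hy hne hyS hadj ?_
  by_cases hDB : ballClass G φ m y = B m
  · obtain ⟨b, hb⟩ := nonempty_of_mem_ballClasses (h.B_mem (m + 1))
    obtain ⟨z, hz, hzB⟩ := h.B_adj m b hb
    rw [hDB]
    exact ⟨z, hzB, b, hb, hz.symm⟩
  · exact h.canAdj_B_of_ne hcls hDA hDB ⟨y, hself, v, hvS, hy.symm⟩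

theorem not_hasThreeNbrs (h : SpecialFrame G φ S A B) (n : ℕ) (v : V) :
    ¬ HasThreeNbrs G φ n v := by
  by_cases hstab : ∃ v N, ∀ m ≥ N, v ∉ S m
  · obtain ⟨u, N, hu⟩ := hstab
    exact h.not_hasThreeNbrs_of_stable hu n v
  push Not at hstab
  intro h3
  choose ν hν using h.exists_not_adj_both
  obtain ⟨N, hN⟩ := ((h.fin v).image ν).bddAbove
  obtain ⟨m, hm, hvm⟩ := hstab v (max n N)
  have h3' := h3.mono h.tree.connected (show n ≤ m by omega)
  have hboth : ∀ y, G.Adj v y →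
      ∀ a ∈ A (m + 1), ∀ b ∈ B (m + 1), G.Adj y a → ¬ G.Adj y b := by
    intro y hy
    have : ν y ≤ N := hN ⟨y, hy, rfl⟩
    exact hν y m (by omega)
  rcases h.mem_or_mem hvm with hA | hB
  · exact h.false_of_mem_A_of_cover hA h3' hboth
  · exact h.swap.false_of_mem_A_of_cover hB h3'
      fun y hy b hb a ha h1 h2 => hboth y hy a ha b hb h2 h1

end SpecialFrame

/-! ### Cycles through the special class -/

section Cycles

variable {V α : Type} {G : SimpleGraph V} {φ : V → α} {n : ℕ}

theorem mod_eq_ite_of_lt_two_mul {a k : ℕ} (h : a < 2 * k) :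
    a % k = if a < k then a else a - k := by
  split_ifs with h1
  · exact Nat.mod_eq_of_lt h1
  · rw [Nat.mod_eq_sub_mod (by omega), Nat.mod_eq_of_lt (by omega)]

theorem IsCycleIn.of_path {K : ℕ} {p : ℕ → Set V} (hK : 2 ≤ K)
    (hmem : ∀ i ≤ K, p i ∈ ballClasses G φ n) (hadj : ∀ i < K, CanAdj G (p i) (p (i + 1)))
    (hlast : CanAdj G (p K) (p 0)) (hinj : ∀ i ≤ K, ∀ j ≤ K, p i = p j → i = j) :
    IsCycleIn G φ n (K + 1) p := by
  refine ⟨by omega, fun i hi => hmem i (by omega), fun i hi => ?_,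
    fun i hi j hj => hinj i (by omega) j (by omega)⟩
  rcases Nat.lt_succ_iff_lt_or_eq.1 hi with h | rfl
  · rw [Nat.mod_eq_of_lt (by omega)]
    exact hadj i h
  · rw [Nat.mod_self]
    exact hlast

theorem IsCycleIn.length_le (hSt : IsSturmian G φ) {k : ℕ} {c : ℕ → Set V}
    (h : IsCycleIn G φ n k c) : k ≤ n + 2 := by
  rw [← hSt n]
  have hfin : (ballClasses G φ n).Finite :=
    Set.finite_of_ncard_ne_zero (by rw [hSt n]; omega)
  have := Set.ncard_le_ncard_of_injOn (s := (Finset.range k : Set ℕ)) c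
    (fun i hi => h.2.1 i (by simpa using hi))
    (fun i hi j hj => h.2.2.2 i (by simpa using hi) j (by simpa using hj)) hfin
  rwa [Set.ncard_coe_finset, Finset.card_range] at this

/-- The classes `q 0, …, q L` form a cycle together with `S₀`. -/
structure IsArc {V α : Type} (G : SimpleGraph V) (φ : V → α) (n : ℕ) (S₀ : Set V) (L : ℕ)
    (q : ℕ → Set V) : Prop where
  pos : 1 ≤ L
  mem : ∀ i ≤ L, q i ∈ ballClasses G φ n
  ne : ∀ i ≤ L, q i ≠ S₀
  adj : ∀ i < L, CanAdj G (q i) (q (i + 1))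
  first : CanAdj G (q 0) S₀
  last : CanAdj G (q L) S₀
  inj : ∀ i ≤ L, ∀ j ≤ L, q i = q j → i = j

theorem IsArc.reverse {S₀ : Set V} {L : ℕ} {q : ℕ → Set V} (h : IsArc G φ n S₀ L q) :
    IsArc G φ n S₀ L (fun i => q (L - i)) where
  pos := h.pos
  mem i _ := h.mem _ (by omega)
  ne i _ := h.ne _ (by omega)
  adj i hi := by
    have := (h.adj (L - (i + 1)) (by omega)).symm
    rwa [show L - (i + 1) + 1 = L - i by omega] at this
  first := by simpa using h.last
  last := by simpa using h.first
  inj i hi j hj hij := by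
    have := h.inj _ (by omega) _ (by omega) hij
    omega

theorem IsCycleIn.exists_isArc {k : ℕ} {c : ℕ → Set V} (h : IsCycleIn G φ n k c) {j : ℕ}
    (hj : j < k) :
    ∃ q, IsArc G φ n (c j) (k - 2) q ∧ ∀ i ≤ k - 2, ∃ i' < k, q i = c i' := by
  obtain ⟨hk, hmem, hadj, hinj⟩ := h
  have hlt : ∀ a, a % k < k := fun a => Nat.mod_lt a (by omega)
  have hmod : ∀ i ≤ k - 2, (j + 1 + i) % k = if j + 1 + i < k then j + 1 + i else
      j + 1 + i - k := fun i hi => mod_eq_ite_of_lt_two_mul (by omega)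
  refine ⟨fun i => c ((j + 1 + i) % k), ?_, fun i _ => ⟨_, hlt _, rfl⟩⟩
  constructor
  · omega
  · exact fun i _ => hmem _ (hlt _)
  · intro i hi e
    have := hinj _ (hlt _) _ hj e
    rw [hmod i hi] at this
    split_ifs at this <;> omega
  · intro i _
    have := hadj _ (hlt (j + 1 + i))
    rwa [Nat.mod_add_mod] at this
  · exact (hadj j hj).symm
  · have := hadj _ (hlt (j + 1 + (k - 2)))
    rwa [Nat.mod_add_mod, show j + 1 + (k - 2) + 1 = j + k by omega, Nat.add_mod_right,
      Nat.mod_eq_of_lt hj] at this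
  · intro i hi i' hi' e
    have := hinj _ (hlt _) _ (hlt _) e
    rw [hmod i hi, hmod i' hi'] at this
    split_ifs at this <;> omega

end Cycles

namespace SpecialFrame

variable {V α : Type} {G : SimpleGraph V} {φ : V → α} {S A B : ℕ → Set V}
  {n L : ℕ} {q : ℕ → Set V}

theorem false_of_four_classes (h : SpecialFrame G φ S A B) {D D₁ D₂ D₃ : Set V} {u : V}
    (hu : u ∈ D) (hD : D ∈ ballClasses G φ n) (hD₁ : D₁ ∈ ballClasses G φ n)
    (hD₂ : D₂ ∈ ballClasses G φ n) (hD₃ : D₃ ∈ ballClasses G φ n)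
    (hu₁ : ∃ y, G.Adj u y ∧ y ∈ D₁) (hu₂ : ∃ y, G.Adj u y ∧ y ∈ D₂)
    (hu₃ : ∃ y, G.Adj u y ∧ y ∈ D₃) (h1 : D ≠ D₁) (h2 : D ≠ D₂) (h3 : D ≠ D₃)
    (h4 : D₁ ≠ D₂) (h5 : D₁ ≠ D₃) (h6 : D₂ ≠ D₃) : False := by
  have key : ∀ {E E' : Set V} {x y : V}, E ∈ ballClasses G φ n → E' ∈ ballClasses G φ n →
      x ∈ E → y ∈ E' → E ≠ E' → ¬ BallEquiv G φ n x y := fun hE hE' hx hy hne hxy =>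
    hne (eq_of_mem_of_mem hE hE' ((mem_iff_ballEquiv hE hx).2 hxy) hy)
  obtain ⟨x, hx, hx'⟩ := hu₁
  obtain ⟨y, hy, hy'⟩ := hu₂
  obtain ⟨z, hz, hz'⟩ := hu₃
  exact h.not_hasThreeNbrs n u ⟨x, y, z, hx, hy, hz, key hD hD₁ hu hx' h1,
    key hD hD₂ hu hy' h2, key hD hD₃ hu hz' h3, key hD₁ hD₂ hx' hy' h4,
    key hD₁ hD₃ hx' hz' h5, key hD₂ hD₃ hy' hz' h6⟩

theorem ne_A_succ (h : SpecialFrame G φ S A B) {D : Set V} (hD : D ∈ ballClasses G φ n)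
    (hne : D ≠ S n) : D ≠ A (n + 1) := by
  rintro rfl
  obtain ⟨a, ha⟩ := nonempty_of_mem_ballClasses (h.A_mem (n + 1))
  exact hne (eq_of_mem_of_mem hD (h.S_mem n) ha (h.A_sub n ha))

theorem ne_B_succ (h : SpecialFrame G φ S A B) {D : Set V} (hD : D ∈ ballClasses G φ n)
    (hne : D ≠ S n) : D ≠ B (n + 1) :=
  h.swap.ne_A_succ hD hne

theorem canAdj_A_succ (h : SpecialFrame G φ S A B) (n : ℕ) : CanAdj G (A (n + 1)) (A n) := by
  obtain ⟨a, ha⟩ := nonempty_of_mem_ballClasses (h.A_mem (n + 1))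
  obtain ⟨y, hy, hyA⟩ := h.A_adj n a ha
  exact ⟨a, ha, y, hyA, hy⟩

theorem canAdj_B_succ (h : SpecialFrame G φ S A B) (n : ℕ) : CanAdj G (B (n + 1)) (B n) :=
  h.swap.canAdj_A_succ n

theorem exists_eq_S_of_isCycleIn (h : SpecialFrame G φ S A B) {k : ℕ} {c : ℕ → Set V}
    (hc : IsCycleIn G φ n k c) : ∃ i < k, c i = S n := by
  by_contra! hne
  obtain ⟨hk, hmem, hadj, hinj⟩ := hc
  obtain ⟨u, hu⟩ := nonempty_of_mem_ballClasses (hmem 0 (by omega))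
  obtain ⟨s, hs⟩ := nonempty_of_mem_ballClasses (h.S_mem n)
  obtain ⟨x, ⟨i, hi, hx⟩, y, hy, hxy⟩ := exists_adj_mem_notMem (U := {u | ∃ i < k, u ∈ c i})
    h.tree.connected ⟨0, by omega, hu⟩
    (fun ⟨i, hi, hsi⟩ => hne i hi (eq_of_mem_of_mem (hmem i hi) (h.S_mem n) hsi hs))
  have hyc : ∀ j < k, c j ≠ ballClass G φ n y := fun j hj e =>
    hy ⟨j, hj, e ▸ self_mem_ballClass n y⟩
  have hnext := mod_eq_ite_of_lt_two_mul (show i + 1 < 2 * k by omega)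
  have hprev := mod_eq_ite_of_lt_two_mul (show i + (k - 1) < 2 * k by omega)
  have hnl : (i + 1) % k < k := Nat.mod_lt _ (by omega)
  have hpl : (i + (k - 1)) % k < k := Nat.mod_lt _ (by omega)
  have hpadj := hadj _ hpl
  rw [Nat.mod_add_mod, show i + (k - 1) + 1 = i + k by omega, Nat.add_mod_right,
    Nat.mod_eq_of_lt hi] at hpadj
  refine h.false_of_four_classes hx (hmem i hi) (hmem _ hnl) (hmem _ hpl)
    (ballClass_mem_ballClasses n y)
    (h.alwaysAdjTo (hmem i hi) (hne i hi) (hmem _ hnl) (hadj i hi) x hx)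
    (h.alwaysAdjTo (hmem i hi) (hne i hi) (hmem _ hpl) hpadj.symm x hx)
    ⟨y, hxy, self_mem_ballClass n y⟩ ?_ ?_ (hyc i hi) ?_ (hyc _ hnl) (hyc _ hpl)
  · intro e
    have := hinj _ hi _ hnl e
    split_ifs at hnext <;> omega
  · intro e
    have := hinj _ hi _ hpl e
    split_ifs at hprev <;> omega
  · intro e
    have := hinj _ hnl _ hpl e
    split_ifs at hnext hprev <;> omega

theorem eq_A_or_eq_B_of_adj (h : SpecialFrame G φ S A B) {D D' : Set V}
    (hD : D ∈ ballClasses G φ n) (hDS : D ≠ S n) (hDS' : D ≠ S (n + 1))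
    (hadj : CanAdj G D (S n)) (hD' : D' ∈ ballClasses G φ n) (hD'S : D' ≠ S n)
    (hne : D ≠ D') (hadj' : CanAdj G D D') : D = A n ∨ D = B n := by
  by_contra! hcon
  obtain ⟨u, hu⟩ := nonempty_of_mem_ballClasses hD
  have h1 := h.mem_ballClasses_succ hD hDS
  have h2 := h.mem_ballClasses_succ hD' hD'S
  exact h.false_of_four_classes hu h1 (h.A_mem _) (h.B_mem _) h2
    (h.alwaysAdjTo h1 hDS' (h.A_mem _) (h.canAdj_A_of_ne hD hcon.1 hcon.2 hadj) u hu)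
    (h.alwaysAdjTo h1 hDS' (h.B_mem _) (h.canAdj_B_of_ne hD hcon.1 hcon.2 hadj) u hu)
    (h.alwaysAdjTo h1 hDS' h2 hadj' u hu) (h.ne_A_succ hD hDS) (h.ne_B_succ hD hDS) hne
    (h.AB_ne _) (h.ne_A_succ hD' hD'S).symm (h.ne_B_succ hD' hD'S).symm

theorem exists_isArc_A_B (h : SpecialFrame G φ S A B) (hq : IsArc G φ n (S n) L q)
    (hS : ∀ i ≤ L, q i ≠ S (n + 1)) :
    ∃ p, IsArc G φ n (S n) L p ∧ p 0 = A n ∧ p L = B n ∧ ∀ i ≤ L, p i ≠ S (n + 1) := by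
  have hL := hq.pos
  have h0 : q 0 = A n ∨ q 0 = B n :=
    h.eq_A_or_eq_B_of_adj (hq.mem 0 (by omega)) (hq.ne 0 (by omega)) (hS 0 (by omega))
      hq.first (hq.mem 1 hL) (hq.ne 1 hL)
      (fun e => by have := hq.inj 0 (by omega) 1 hL e; omega) (hq.adj 0 (by omega))
  have hL' : q L = A n ∨ q L = B n := by
    have hadj := (hq.adj (L - 1) (by omega)).symm
    rw [show L - 1 + 1 = L by omega] at hadj
    exact h.eq_A_or_eq_B_of_adj (hq.mem L le_rfl) (hq.ne L le_rfl) (hS L le_rfl)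
      hq.last (hq.mem (L - 1) (by omega)) (hq.ne (L - 1) (by omega))
      (fun e => by have := hq.inj L le_rfl (L - 1) (by omega) e; omega) hadj
  have hne : q 0 ≠ q L := fun e => by
    have := hq.inj 0 (by omega) L le_rfl e
    omega
  rcases h0 with h0 | h0
  · refine ⟨q, hq, h0, hL'.resolve_left fun e => hne (h0.trans e.symm), hS⟩
  · refine ⟨_, hq.reverse, ?_, ?_, fun i _ => hS _ (by omega)⟩
    · simpa using hL'.resolve_right fun e => hne (h0.trans e.symm)
    · simpa using h0

theorem exists_isCycleIn_succ (h : SpecialFrame G φ S A B) {C : Set V}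
    (hC : C ∈ ballClasses G φ n) (hSC : S (n + 1) ⊆ C) {k : ℕ} {c : ℕ → Set V}
    (hc : IsCycleIn G φ n k c) (hcC : ∀ i < k, c i ≠ C) :
    ∃ c', IsCycleIn G φ (n + 1) (k + 2) c' := by
  have hk := hc.1
  obtain ⟨j, hj, hjS⟩ := h.exists_eq_S_of_isCycleIn hc
  have hCS : C ≠ S n := fun e => hcC j hj (hjS.trans e.symm)
  have hS1 := h.eq_of_subset hC hSC hCS
  obtain ⟨q, hq, hqc⟩ := hc.exists_isArc hj
  rw [hjS] at hq
  obtain ⟨p, hp, hp0, hpL, hpS⟩ := h.exists_isArc_A_B hq fun i hi e => by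
    obtain ⟨i', hi', e'⟩ := hqc i hi
    exact hcC i' hi' (by rw [← e', e, hS1])
  obtain ⟨L, rfl⟩ : ∃ L, k = L + 2 := ⟨k - 2, by omega⟩
  rw [Nat.add_sub_cancel] at *
  let c' : ℕ → Set V := fun i => if i ≤ L then p i else
    if i = L + 1 then B (n + 1) else if i = L + 2 then S (n + 1) else A (n + 1)
  have e0 : ∀ i ≤ L, c' i = p i := fun i hi => by simp [c', hi]
  have e1 : c' (L + 1) = B (n + 1) := by simp [c']
  have e2 : c' (L + 2) = S (n + 1) := by simp [c']
  have e3 : c' (L + 3) = A (n + 1) := by simp [c']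
  have hcases : ∀ i ≤ L + 3, i ≤ L ∨ i = L + 1 ∨ i = L + 2 ∨ i = L + 3 := by omega
  have hpA : ∀ i ≤ L, p i ≠ A (n + 1) := fun i hi => h.ne_A_succ (hp.mem i hi) (hp.ne i hi)
  have hpB : ∀ i ≤ L, p i ≠ B (n + 1) := fun i hi => h.ne_B_succ (hp.mem i hi) (hp.ne i hi)
  have hSA : S (n + 1) ≠ A (n + 1) := hS1 ▸ h.ne_A_succ hC hCS
  have hSB : S (n + 1) ≠ B (n + 1) := hS1 ▸ h.ne_B_succ hC hCS
  refine ⟨c', IsCycleIn.of_path (K := L + 3) (by omega) ?_ ?_ ?_ ?_⟩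
  · intro i hi
    rcases hcases i hi with hi | rfl | rfl | rfl
    · rw [e0 i hi]
      exact h.mem_ballClasses_succ (hp.mem i hi) (hp.ne i hi)
    · rw [e1]; exact h.B_mem _
    · rw [e2]; exact h.S_mem _
    · rw [e3]; exact h.A_mem _
  · intro i hi
    rcases (show i < L ∨ i = L ∨ i = L + 1 ∨ i = L + 2 by omega) with hi | rfl | rfl | rfl
    · rw [e0 i hi.le, e0 (i + 1) hi]
      exact hp.adj i hi
    · rw [e0 i le_rfl, e1, hpL]
      exact (h.canAdj_B_succ n).symm
    · rw [e1, e2]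
      exact (h.canAdj_S_B n).symm
    · rw [e2, e3]
      exact h.canAdj_S_A n
  · rw [e3, e0 0 (by omega), hp0]
    exact h.canAdj_A_succ n
  · intro i hi i' hi' e
    rcases hcases i hi with hi | rfl | rfl | rfl <;>
      rcases hcases i' hi' with hi' | rfl | rfl | rfl <;>
      simp only [e0, e1, e2, e3, hi, hi'] at e <;> first
      | rfl
      | exact hp.inj _ hi _ hi' e
      | exact absurd e (hpA _ hi)
      | exact absurd e (hpB _ hi)
      | exact absurd e (hpS _ hi)
      | exact absurd e.symm (hpA _ hi')
      | exact absurd e.symm (hpB _ hi')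
      | exact absurd e.symm (hpS _ hi')
      | exact absurd e hSA
      | exact absurd e hSB
      | exact absurd e.symm hSA
      | exact absurd e.symm hSB
      | exact absurd e (h.AB_ne _)
      | exact absurd e.symm (h.AB_ne _)

theorem exists_isCycleIn_of_S_eq_B (h : SpecialFrame G φ S A B)
    (hq : IsArc G φ n (S n) L q) (hq0 : q 0 = A n) (hqL : q L = B n)
    (hS1 : S (n + 1) = B (n + 1)) {C : Set V} (hC : C ∈ ballClasses G φ (n + 1))
    (hSC : S (n + 2) ⊆ C) :
    C ≠ S (n + 1) ∧ ∃ k c, IsCycleIn G φ (n + 1) k c ∧ ∃ i < k, c i = C := by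
  have hL := hq.pos
  have hqA : ∀ i ≤ L, q i ≠ A (n + 1) := fun i hi => h.ne_A_succ (hq.mem i hi) (hq.ne i hi)
  have hqB : ∀ i ≤ L, q i ≠ B (n + 1) := fun i hi => h.ne_B_succ (hq.mem i hi) (hq.ne i hi)
  have hqmem : ∀ i ≤ L, q i ∈ ballClasses G φ (n + 1) := fun i hi =>
    h.mem_ballClasses_succ (hq.mem i hi) (hq.ne i hi)
  have hCS : C ≠ S (n + 1) := by
    intro e
    have hne : q L ≠ S (n + 2) := by
      intro e'
      obtain ⟨s, hs⟩ := nonempty_of_mem_ballClasses (h.S_mem (n + 2))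
      refine hqB L le_rfl ?_
      rw [← hS1]
      exact eq_of_mem_of_mem (hqmem L le_rfl) (h.S_mem _) (e' ▸ hs) (e ▸ hSC hs)
    have hadj := (hq.adj (L - 1) (by omega)).symm
    rw [show L - 1 + 1 = L by omega] at hadj
    have := h.eq_A_or_eq_B_of_adj (hqmem L le_rfl) (hS1 ▸ hqB L le_rfl) hne
      (by rw [hqL, hS1]; exact (h.canAdj_B_succ n).symm)
      (hqmem (L - 1) (by omega)) (hS1 ▸ hqB (L - 1) (by omega))
      (fun e => by have := hq.inj L le_rfl (L - 1) (by omega) e; omega) hadj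
    exact this.elim (hqA L le_rfl) (hqB L le_rfl)
  refine ⟨hCS, ?_⟩
  let c : ℕ → Set V := fun i => if i ≤ L then q i else
    if i = L + 1 then B (n + 1) else A (n + 1)
  have e0 : ∀ i ≤ L, c i = q i := fun i hi => by simp [c, hi]
  have e1 : c (L + 1) = B (n + 1) := by simp [c]
  have e2 : c (L + 2) = A (n + 1) := by simp [c]
  have hcases : ∀ i ≤ L + 2, i ≤ L ∨ i = L + 1 ∨ i = L + 2 := by omega
  refine ⟨L + 2 + 1, c, IsCycleIn.of_path (by omega) ?_ ?_ ?_ ?_, ?_⟩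
  · intro i hi
    rcases hcases i hi with hi | rfl | rfl
    · rw [e0 i hi]
      exact hqmem i hi
    · rw [e1]; exact h.B_mem _
    · rw [e2]; exact h.A_mem _
  · intro i hi
    rcases (show i < L ∨ i = L ∨ i = L + 1 by omega) with hi | rfl | rfl
    · rw [e0 i hi.le, e0 (i + 1) hi]
      exact hq.adj i hi
    · rw [e0 i le_rfl, e1, hqL]
      exact (h.canAdj_B_succ n).symm
    · rw [e1, e2, ← hS1]
      exact h.canAdj_S_A n
  · rw [e2, e0 0 (by omega), hq0]
    exact h.canAdj_A_succ n
  · intro i hi i' hi' e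
    rcases hcases i hi with hi | rfl | rfl <;>
      rcases hcases i' hi' with hi' | rfl | rfl <;>
      simp only [e0, e1, e2, hi, hi'] at e <;> first
      | rfl
      | exact hq.inj _ hi _ hi' e
      | exact absurd e (hqA _ hi)
      | exact absurd e (hqB _ hi)
      | exact absurd e.symm (hqA _ hi')
      | exact absurd e.symm (hqB _ hi')
      | exact absurd e (h.AB_ne _)
      | exact absurd e.symm (h.AB_ne _)
  · by_cases hCA : C = A (n + 1)
    · exact ⟨L + 2, by omega, e2.trans hCA.symm⟩
    obtain ⟨m, hm, hCm, hCSm⟩ := h.exists_eq_succ_of_ne hC hCA (hS1 ▸ hCS)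
    obtain rfl : n = m := by omega
    by_cases hCA' : C = A n
    · exact ⟨0, by omega, by rw [e0 0 (by omega), hq0, hCA']⟩
    by_cases hCB' : C = B n
    · exact ⟨L, by omega, by rw [e0 L le_rfl, hqL, hCB']⟩
    exfalso
    have hadjC : CanAdj G C (S n) := (h.canAdj_S_A (n + 1)).mono hSC
      ((h.A_sub (n + 1)).trans (hS1 ▸ h.B_sub n))
    have hAS : A (n + 1) ≠ S (n + 1) := hS1 ▸ h.AB_ne (n + 1)
    obtain ⟨u, hu⟩ := nonempty_of_mem_ballClasses (h.A_mem (n + 1))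
    have hA0 := hqmem 0 (by omega)
    have hA0A := hqA 0 (by omega)
    have hA0B := hqB 0 (by omega)
    rw [hq0] at hA0 hA0A hA0B
    exact h.false_of_four_classes hu (h.A_mem _) hC hA0 (h.B_mem _)
      (h.alwaysAdjTo (h.A_mem _) hAS hC (h.canAdj_A_of_ne hCm hCA' hCB' hadjC).symm u hu)
      (h.A_adj n u hu)
      (h.alwaysAdjTo (h.A_mem _) hAS (h.B_mem _) (hS1 ▸ (h.canAdj_S_A n).symm) u hu)
      (Ne.symm hCA) hA0A.symm (h.AB_ne _) hCA' (hS1 ▸ hCS) hA0B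

theorem exists_isCycleIn_of_eq_S (h : SpecialFrame G φ S A B) (hSS : S (n + 1) ⊆ S n)
    {k : ℕ} {c : ℕ → Set V} (hc : IsCycleIn G φ n k c) {C : Set V}
    (hC : C ∈ ballClasses G φ (n + 1)) (hSC : S (n + 2) ⊆ C) :
    C ≠ S (n + 1) ∧ ∃ k c, IsCycleIn G φ (n + 1) k c ∧ ∃ i < k, c i = C := by
  obtain ⟨j, hj, hjS⟩ := h.exists_eq_S_of_isCycleIn hc
  obtain ⟨q, hq, -⟩ := hc.exists_isArc hj
  rw [hjS] at hq
  have hS1 := h.eq_or_eq_of_subset hSS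
  obtain ⟨p, hp, hp0, hpL, -⟩ := h.exists_isArc_A_B hq fun i hi e => hS1.elim
    (fun e' => h.ne_A_succ (hq.mem i hi) (hq.ne i hi) (e.trans e'))
    (fun e' => h.ne_B_succ (hq.mem i hi) (hq.ne i hi) (e.trans e'))
  rcases hS1 with hS1 | hS1
  · exact h.swap.exists_isCycleIn_of_S_eq_B hp.reverse (by simpa using hpL)
      (by simpa using hp0) hS1 hC hSC
  · exact h.exists_isCycleIn_of_S_eq_B hp hp0 hpL hS1 hC hSC

end SpecialFrame

theorem Labeling.C_mem {V α : Type} {G : SimpleGraph V} {φ : V → α} {a b : α}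
    (L : Labeling G φ a b) (n : ℕ) : L.C n ∈ ballClasses G φ n := by
  obtain ⟨x, -, -, hC⟩ := L.C_central n
  exact ⟨x, hC⟩

theorem Labeling.S_succ_subset_C {V α : Type} {G : SimpleGraph V} {φ : V → α} {a b : α}
    (hc : G.Connected) (L : Labeling G φ a b) (n : ℕ) : L.S (n + 1) ⊆ L.C n := by
  obtain ⟨x, -, hS, hC⟩ := L.C_central n
  rw [hS, hC]
  exact fun y hy => hy.mono hc (by omega)

/-- Lemma 5.2 and Lemma 5.3: (1) if `G_n` has a cycle not containing
`C_n`, then `G_{n+ℓ}` has a cycle containing `C_{n+ℓ}` for some `ℓ ≥ 1`; (2) if `G_n`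
has a cycle containing `C_n = S_n`, then `G_{n+1}` has a cycle containing
`C_{n+1} ≠ S_{n+1}`. -/
theorem cycle_evolution {V α : Type} (G : SimpleGraph V) (d : ℕ) (hd : 3 ≤ d)
    (hT : IsRegularTree G d) (φ : V → α) (hSt : IsSturmian G φ)
    (a b : α) (hab : a ≠ b) (L : Labeling G φ a b) (n : ℕ) :
    ((∃ k c, IsCycleIn G φ n k c ∧ ∀ i < k, c i ≠ L.C n) →
      ∃ l : ℕ, 1 ≤ l ∧ ∃ k c, IsCycleIn G φ (n + l) k c ∧ ∃ i < k, c i = L.C (n + l)) ∧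
    ((L.C n = L.S n ∧ ∃ k c, IsCycleIn G φ n k c ∧ ∃ i < k, c i = L.C n) →
      L.C (n + 1) ≠ L.S (n + 1) ∧
      ∃ k c, IsCycleIn G φ (n + 1) k c ∧ ∃ i < k, c i = L.C (n + 1)) := by
  have h := L.specialFrame (by omega) hT hSt hab
  have hSC := L.S_succ_subset_C hT.isTree.connected
  constructor
  · rintro ⟨k, c, hc, hcC⟩
    by_contra! hcon
    have hgrow : ∀ l, ∃ c, IsCycleIn G φ (n + l) (k + 2 * l) c ∧
        ∀ i < k + 2 * l, c i ≠ L.C (n + l) := by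
      intro l
      induction l with
      | zero => exact ⟨c, hc, hcC⟩
      | succ l ih =>
        obtain ⟨c, hc, hcC⟩ := ih
        obtain ⟨c', hc'⟩ := h.exists_isCycleIn_succ (L.C_mem _) (hSC _) hc hcC
        exact ⟨c', hc', hcon (l + 1) (by omega) _ c' hc'⟩
    obtain ⟨c', hc', -⟩ := hgrow (n + 2)
    have := hc'.length_le hSt
    have := hc.1
    omega
  · rintro ⟨hCS, k, c, hc, -⟩
    exact h.exists_isCycleIn_of_eq_S (hCS ▸ hSC n) hc (L.C_mem _) (hSC _)

end Sturm
end
end
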